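/- Let (X,T) be an invertible topological dynamical system with h(X,T) > 0, and let δ satisfy 0 < δ < sup{ d(x,y) : (x,y) ∈ E(X,T) }. Then there exist an uncountable subset F of X and, for every x ∈ F, an uncountable subset F_x of X such that for every y ∈ F_x: lim_{n→+∞} d(T^n x, T^n y) = 0; lim inf_{n→+∞} d(T^{-n} x, T^{-n} y) = 0; and lim sup_{n→+∞} d(T^{-n} x, T^{-n} y) ≥ δ. -/

import Mathlib

open MeasureTheory Filter Topology Set
open scoped symmDiff Classical ENNReal NNReal

section Defs

variable {X : Type*}

/-- The pair `(x, y)` is (positively) asymptotic for `T`. -/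
def IsAsymptoticPair [PseudoMetricSpace X] (T : X → X) (x y : X) : Prop :=
  Tendsto (fun n : ℕ => dist (T^[n] x) (T^[n] y)) atTop (𝓝 0)

/-- Shannon entropy of the finite measurable partition of `X` given by the fibers of a
map `p` into a finite type. -/
noncomputable def partEntropy [MeasurableSpace X] (μ : Measure X) {ι : Type*} [Fintype ι]
    (p : X → ι) : ℝ :=
  ∑ i : ι, Real.negMulLog (μ (p ⁻¹' {i})).toReal

/-- Conditional Shannon entropy `H(P | F)` of the finite partition given by the fibers
of `p` with respect to the sub-σ-algebra `F`:
`H(P|F) = ∑_{A ∈ P} ∫ -E(1_A|F) log E(1_A|F) dμ`. -/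
noncomputable def condPartEntropy [MeasurableSpace X] (μ : Measure X)
    (F : MeasurableSpace X) {ι : Type*} [Fintype ι] (p : X → ι) : ℝ :=
  ∑ i : ι, ∫ x, Real.negMulLog ((μ[(p ⁻¹' {i}).indicator (fun _ => (1 : ℝ)) | F]) x) ∂μ

/-- The σ-algebra `σ(P^-)` generated by the partitions `T^{-n}P`, `n ≥ 1`
(the "past" of the partition given by the fibers of `p`). -/
def partPast (T : X → X) {ι : Type*} (p : X → ι) : MeasurableSpace X :=
  ⨆ n : ℕ, MeasurableSpace.comap (fun x => p (T^[n + 1] x)) ⊤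

/-- The σ-algebra `σ(P^T)` generated by the partitions `T^{-n}P`, `n ∈ ℤ`, where `S = T⁻¹`. -/
def partHull (T S : X → X) {ι : Type*} (p : X → ι) : MeasurableSpace X :=
  ⨆ n : ℕ,
    MeasurableSpace.comap (fun x => p (T^[n] x)) ⊤ ⊔
      MeasurableSpace.comap (fun x => p (S^[n] x)) ⊤

/-- Kolmogorov–Sinai entropy of a finite partition: `h_μ(P, T) = H(P | P^-)`. -/
noncomputable def partKS [MeasurableSpace X] (μ : Measure X) (T : X → X) {ι : Type*}
    [Fintype ι] (p : X → ι) : ℝ :=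
  condPartEntropy μ (partPast T p) p

/-- Kolmogorov–Sinai (measure-theoretic) entropy `h_μ(X, T)` of the system:
the supremum over all finite measurable partitions `P` of `h_μ(P, T)`. -/
noncomputable def ksEntropy [MeasurableSpace X] (μ : Measure X) (T : X → X) : ℝ≥0∞ :=
  ⨆ (k : ℕ) (p : X → Fin k) (_ : Measurable p), ENNReal.ofReal (partKS μ T p)

/-- The Pinsker σ-algebra `Π_μ`: the σ-algebra generated by all finite measurable
partitions with zero Kolmogorov–Sinai entropy. -/
def pinskerAlg [MeasurableSpace X] (μ : Measure X) (T : X → X) : MeasurableSpace X :=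
  ⨆ (k : ℕ) (p : X → Fin k) (_ : Measurable p) (_ : partKS μ T p = 0),
    MeasurableSpace.comap p ⊤

/-- Minimal cardinality of a subcover of `⋁_{i=0}^{n-1} T^{-i} C`, where `C` is a
finite cover of `X`. -/
noncomputable def coverNum (T : X → X) {k : ℕ} (C : Fin k → Set X) (n : ℕ) : ℕ :=
  sInf {m : ℕ | ∃ f : Fin m → Fin n → Fin k,
    (⋃ j : Fin m, ⋂ i : Fin n, T^[(i : ℕ)] ⁻¹' C (f j i)) = Set.univ}

/-- Topological entropy of a finite cover `C`:
`h(C, T) = inf_n (1/n) log N(⋁_{i=0}^{n-1} T^{-i} C) = lim_n (1/n) log N(...)`. -/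
noncomputable def coverEntropyOf (T : X → X) {k : ℕ} (C : Fin k → Set X) : ℝ :=
  ⨅ n : ℕ, Real.log (coverNum T C (n + 1)) / (n + 1)

/-- `(x, y)` is a topological entropy pair: `x ≠ y` and every two-set open cover
`{Uᶜ, Vᶜ}`, where `U` and `V` are disjoint closed neighbourhoods of `x` and `y`,
has positive topological entropy. -/
def IsEntropyPair [TopologicalSpace X] (T : X → X) (x y : X) : Prop :=
  x ≠ y ∧ ∀ U V : Set X, IsClosed U → IsClosed V → U ∈ 𝓝 x → V ∈ 𝓝 y → Disjoint U V →
    0 < coverEntropyOf T ![Uᶜ, Vᶜ]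

/-- `(x, y)` is an entropy pair for the invariant measure `μ`: `x ≠ y` and every two-set
Borel partition `(A, Aᶜ)` with `x ∈ interior A` and `y ∈ interior Aᶜ` has positive
entropy with respect to `T` and `μ`. -/
def IsMuEntropyPair [TopologicalSpace X] [MeasurableSpace X] (T : X → X) (μ : Measure X)
    (x y : X) : Prop :=
  x ≠ y ∧ ∀ A : Set X, MeasurableSet A → x ∈ interior A → y ∈ interior Aᶜ →
    0 < partKS μ T (fun z => if z ∈ A then (0 : Fin 2) else 1)

/-- `ν` is the relatively independent square `μ ⊠_G μ` of `μ` over the sub-σ-algebra `G`: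
it is determined by `ν(A × B) = ∫ E(1_A|G) · E(1_B|G) dμ` for all Borel sets `A`, `B`. -/
def IsCondSquare (G : MeasurableSpace X) [m0 : MeasurableSpace X] (μ : Measure X)
    (ν : Measure (X × X)) : Prop :=
  ∀ A B : Set X, MeasurableSet[m0] A → MeasurableSet[m0] B →
    ν (A ×ˢ B) = ENNReal.ofReal
      (∫ x, (μ[A.indicator (fun _ => (1 : ℝ)) | G]) x *
            (μ[B.indicator (fun _ => (1 : ℝ)) | G]) x ∂μ)

/-- The σ-algebra `m₁` is contained in `m₂` modulo `μ`-null sets. -/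
def SubModNull [MeasurableSpace X] (μ : Measure X) (m₁ m₂ : MeasurableSpace X) : Prop :=
  ∀ A : Set X, MeasurableSet[m₁] A → ∃ B : Set X, MeasurableSet[m₂] B ∧ μ (A ∆ B) = 0

end Defs

section Defs2

variable {X : Type*}

/-- The σ-algebra `F^- = ⋁_{n ≥ 1} T^{-n} F`. -/
def pastAlg (T : X → X) (F : MeasurableSpace X) : MeasurableSpace X :=
  ⨆ n : ℕ, MeasurableSpace.comap (T^[n + 1]) F

/-- The σ-algebra `F^T = ⋁_{n ∈ ℤ} T^{-n} F`, where `S = T⁻¹`. -/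
def hullAlg (T S : X → X) (F : MeasurableSpace X) : MeasurableSpace X :=
  ⨆ n : ℕ, MeasurableSpace.comap (T^[n]) F ⊔ MeasurableSpace.comap (S^[n]) F

/-- `P` is (the σ-algebra of) an *excellent* measurable partition for `(X, μ, T)` (here
`S = T⁻¹`): it is generating (`σ(P^T) = 𝒜` mod `μ`) and it is generated by an increasing
sequence of finite measurable partitions `Pₙ ↑ P` with `H(Pₙ|Pₙ⁻) − H(Pₙ|P⁻) → 0`. -/
def IsExcellentPartition (P : MeasurableSpace X) [m0 : MeasurableSpace X] (μ : Measure X)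
    (T S : X → X) : Prop :=
  P ≤ m0 ∧ SubModNull μ m0 (hullAlg T S P) ∧
  ∃ (m : ℕ → ℕ) (Q : ∀ n : ℕ, X → Fin (m n)),
    (∀ n, Measurable (Q n)) ∧
    Monotone (fun n => MeasurableSpace.comap (Q n) (⊤ : MeasurableSpace (Fin (m n)))) ∧
    (⨆ n : ℕ, MeasurableSpace.comap (Q n) (⊤ : MeasurableSpace (Fin (m n)))) = P ∧
    Tendsto (fun n => condPartEntropy μ (partPast T (Q n)) (Q n) -
      condPartEntropy μ (pastAlg T P) (Q n)) atTop (𝓝 0)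

end Defs2

namespace AsymLY

section FinEnt
variable {Ω α : Type*} [Fintype Ω]

/-- The class of `ω` for the joint variable `(Z a)_{a ∈ A}`. -/
noncomputable def agr (Z : α → Ω → ℕ) (A : Finset α) (ω : Ω) : Finset Ω :=
  Finset.univ.filter (fun ω' => ∀ a ∈ A, Z a ω' = Z a ω)

/-- Shannon entropy of `(Z a)_{a ∈ A}` for the uniform measure on `Ω`. -/
noncomputable def fent (Z : α → Ω → ℕ) (A : Finset α) : ℝ :=
  (∑ ω : Ω, Real.log ((Fintype.card Ω : ℝ) / ((agr Z A ω).card : ℝ))) / (Fintype.card Ω : ℝ)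

lemma mem_agr {Z : α → Ω → ℕ} {A : Finset α} {ω ω' : Ω} :
    ω' ∈ agr Z A ω ↔ ∀ a ∈ A, Z a ω' = Z a ω := by simp [agr]

lemma self_mem_agr (Z : α → Ω → ℕ) (A : Finset α) (ω : Ω) : ω ∈ agr Z A ω := by
  simp [agr]

lemma agr_pos (Z : α → Ω → ℕ) (A : Finset α) (ω : Ω) : (0 : ℝ) < ((agr Z A ω).card : ℝ) := by
  exact_mod_cast Finset.card_pos.2 ⟨ω, self_mem_agr Z A ω⟩

lemma agr_eq {Z : α → Ω → ℕ} {A : Finset α} {ω ω' : Ω} (h : ω' ∈ agr Z A ω) :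
    agr Z A ω' = agr Z A ω := by
  rw [mem_agr] at h
  ext x
  simp only [mem_agr]
  constructor
  · intro hx a ha; rw [hx a ha, h a ha]
  · intro hx a ha; rw [hx a ha, h a ha]

lemma agr_anti {Z : α → Ω → ℕ} {A B : Finset α} (h : A ⊆ B) (ω : Ω) :
    agr Z B ω ⊆ agr Z A ω := by
  intro x hx
  rw [mem_agr] at *
  exact fun a ha => hx a (h ha)

lemma card_pos' [Nonempty Ω] : (0 : ℝ) < (Fintype.card Ω : ℝ) := by
  exact_mod_cast Fintype.card_pos

lemma fent_empty [Nonempty Ω] (Z : α → Ω → ℕ) : fent Z ∅ = 0 := by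
  have : ∀ ω : Ω, agr Z ∅ ω = Finset.univ := by intro ω; ext x; simp [mem_agr]
  simp only [fent, this, Finset.card_univ, div_self (card_pos' (Ω := Ω)).ne', Real.log_one]
  simp

lemma fent_mono [Nonempty Ω] (Z : α → Ω → ℕ) {A B : Finset α} (h : A ⊆ B) :
    fent Z A ≤ fent Z B := by
  unfold fent
  refine div_le_div_of_nonneg_right ?_ card_pos'.le
  refine Finset.sum_le_sum fun ω _ => ?_
  refine Real.log_le_log (div_pos card_pos' (agr_pos Z A ω)) ?_
  refine div_le_div_of_nonneg_left card_pos'.le (agr_pos Z B ω) ?_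
  exact_mod_cast Finset.card_le_card (agr_anti h ω)

lemma fent_nonneg [Nonempty Ω] (Z : α → Ω → ℕ) (A : Finset α) : 0 ≤ fent Z A := by
  rw [← fent_empty Z]; exact fent_mono Z (Finset.empty_subset A)

lemma q_sum_le [DecidableEq α] [Nonempty Ω] (Z : α → Ω → ℕ) {A B C : Finset α} (hA : C ⊆ A) (hB : C ⊆ B) :
    ∑ ω : Ω, ((agr Z A ω).card : ℝ) * (agr Z B ω).card /
      ((agr Z (A ∪ B) ω).card * (agr Z C ω).card) ≤ Fintype.card Ω := by
  have key : ∀ α' β : Ω, (∑ ω : Ω, if α' ∈ agr Z A ω ∧ β ∈ agr Z B ω then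
      (1 : ℝ) / ((agr Z (A ∪ B) ω).card * (agr Z C ω).card) else 0) ≤
      if β ∈ agr Z C α' then (1 : ℝ) / (agr Z C α').card else 0 := by
    intro a b
    by_cases hex : ∃ ω₀ : Ω, a ∈ agr Z A ω₀ ∧ b ∈ agr Z B ω₀
    · obtain ⟨ω₀, ha, hb⟩ := hex
      have hC1 : agr Z C a = agr Z C ω₀ := agr_eq (agr_anti hA _ ha)
      have hC2 : b ∈ agr Z C ω₀ := agr_anti hB _ hb
      rw [if_pos (by rw [hC1]; exact hC2), hC1]
      have hiff : ∀ ω : Ω, (a ∈ agr Z A ω ∧ b ∈ agr Z B ω) ↔ ω ∈ agr Z (A ∪ B) ω₀ := by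
        intro ω
        simp only [mem_agr, Finset.mem_union] at *
        constructor
        · rintro ⟨h1, h2⟩ x (hx | hx)
          · rw [← h1 x hx, ha x hx]
          · rw [← h2 x hx, hb x hx]
        · intro h
          exact ⟨fun x hx => by rw [ha x hx, h x (Or.inl hx)],
            fun x hx => by rw [hb x hx, h x (Or.inr hx)]⟩
      have : ∀ ω : Ω, (if a ∈ agr Z A ω ∧ b ∈ agr Z B ω then
          (1 : ℝ) / ((agr Z (A ∪ B) ω).card * (agr Z C ω).card) else 0) =
          if ω ∈ agr Z (A ∪ B) ω₀ then
            (1 : ℝ) / ((agr Z (A ∪ B) ω₀).card * (agr Z C ω₀).card) else 0 := by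
        intro ω
        by_cases hω : ω ∈ agr Z (A ∪ B) ω₀
        · rw [if_pos ((hiff ω).2 hω), if_pos hω, agr_eq hω,
            agr_eq (agr_anti (hA.trans Finset.subset_union_left) _ hω)]
        · rw [if_neg (fun h => hω ((hiff ω).1 h)), if_neg hω]
      rw [Finset.sum_congr rfl (fun ω _ => this ω), Finset.sum_ite_mem]
      simp only [Finset.univ_inter, Finset.sum_const, nsmul_eq_mul]
      have h1 := agr_pos Z (A ∪ B) ω₀
      have h2 := agr_pos Z C ω₀
      apply le_of_eq
      field_simp
    · have : ∀ ω : Ω, ¬ (a ∈ agr Z A ω ∧ b ∈ agr Z B ω) := fun ω h => hex ⟨ω, h⟩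
      simp only [this, if_false, Finset.sum_const_zero]
      split_ifs
      · positivity
      · exact le_rfl
  have e1 : ∀ ω : Ω, ((agr Z A ω).card : ℝ) * (agr Z B ω).card /
      ((agr Z (A ∪ B) ω).card * (agr Z C ω).card) =
      ∑ a : Ω, ∑ b : Ω, if a ∈ agr Z A ω ∧ b ∈ agr Z B ω then
      (1 : ℝ) / ((agr Z (A ∪ B) ω).card * (agr Z C ω).card) else 0 := by
    intro ω
    simp only [ite_and, Finset.sum_ite_irrel, Finset.sum_ite_mem, Finset.univ_inter,
      Finset.sum_const, nsmul_eq_mul]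
    rw [Finset.sum_congr rfl (g := fun a => if a ∈ agr Z A ω then ((agr Z B ω).card : ℝ) *
      (1 / (((agr Z (A ∪ B) ω).card : ℝ) * (agr Z C ω).card)) else 0)
      (fun a _ => by split_ifs <;> simp), Finset.sum_ite_mem]
    simp only [Finset.univ_inter, Finset.sum_const, nsmul_eq_mul]
    ring
  rw [Finset.sum_congr rfl (fun ω _ => e1 ω), Finset.sum_comm]
  have e2 : ∀ a : Ω, (∑ ω : Ω, ∑ b : Ω, if a ∈ agr Z A ω ∧ b ∈ agr Z B ω then
      (1 : ℝ) / ((agr Z (A ∪ B) ω).card * (agr Z C ω).card) else 0) ≤ 1 := by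
    intro a
    rw [Finset.sum_comm]
    refine (Finset.sum_le_sum fun b _ => key a b).trans ?_
    rw [Finset.sum_ite_mem]
    simp only [Finset.univ_inter, Finset.sum_const, nsmul_eq_mul]
    have h2 := agr_pos Z C a
    apply le_of_eq; field_simp
  refine (Finset.sum_le_sum fun a _ => e2 a).trans ?_
  simp

lemma fent_submod [DecidableEq α] [Nonempty Ω] (Z : α → Ω → ℕ) {A B C : Finset α} (hA : C ⊆ A) (hB : C ⊆ B) :
    fent Z (A ∪ B) + fent Z C ≤ fent Z A + fent Z B := by
  have hq := q_sum_le Z hA hB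
  have hcard := card_pos' (Ω := Ω)
  have : ∑ ω : Ω, (Real.log ((Fintype.card Ω : ℝ) / ((agr Z (A ∪ B) ω).card : ℝ)) +
      Real.log ((Fintype.card Ω : ℝ) / ((agr Z C ω).card : ℝ)) -
      Real.log ((Fintype.card Ω : ℝ) / ((agr Z A ω).card : ℝ)) -
      Real.log ((Fintype.card Ω : ℝ) / ((agr Z B ω).card : ℝ))) ≤ 0 := by
    have h1 : ∀ ω : Ω, (Real.log ((Fintype.card Ω : ℝ) / ((agr Z (A ∪ B) ω).card : ℝ)) +
      Real.log ((Fintype.card Ω : ℝ) / ((agr Z C ω).card : ℝ)) -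
      Real.log ((Fintype.card Ω : ℝ) / ((agr Z A ω).card : ℝ)) -
      Real.log ((Fintype.card Ω : ℝ) / ((agr Z B ω).card : ℝ))) ≤
      ((agr Z A ω).card : ℝ) * (agr Z B ω).card /
      ((agr Z (A ∪ B) ω).card * (agr Z C ω).card) - 1 := by
      intro ω
      have a1 := agr_pos Z (A ∪ B) ω
      have a2 := agr_pos Z C ω
      have a3 := agr_pos Z A ω
      have a4 := agr_pos Z B ω
      refine le_trans (le_of_eq ?_) (Real.log_le_sub_one_of_pos (by positivity))
      rw [Real.log_div hcard.ne' a1.ne', Real.log_div hcard.ne' a2.ne',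
        Real.log_div hcard.ne' a3.ne', Real.log_div hcard.ne' a4.ne',
        Real.log_div (by positivity) (by positivity), Real.log_mul a3.ne' a4.ne',
        Real.log_mul a1.ne' a2.ne']
      ring
    refine (Finset.sum_le_sum fun ω _ => h1 ω).trans ?_
    rw [Finset.sum_sub_distrib]
    simp only [Finset.sum_const, Finset.card_univ, nsmul_eq_mul, mul_one]
    linarith
  simp only [Finset.sum_add_distrib, Finset.sum_sub_distrib] at this
  unfold fent
  rw [← add_div, ← add_div]
  exact div_le_div_of_nonneg_right (by linarith) hcard.le

/-- If in each `G`-class the variable `D` takes at most `p` values then `H(D|G) ≤ log p`. -/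
lemma fent_cond_le [DecidableEq α] [Nonempty Ω] (Z : α → Ω → ℕ) (D G : Finset α) (p : ℕ)
    {β : Type*} [DecidableEq β]
    (pat : Ω → β)
    (hpat : ∀ ω ω', pat ω = pat ω' ↔ ∀ a ∈ D, Z a ω = Z a ω')
    (hp : ∀ ω : Ω, ((agr Z G ω).image pat).card ≤ p) :
    fent Z (D ∪ G) - fent Z G ≤ Real.log p := by
  have hcard := card_pos' (Ω := Ω)
  have hp0 : 0 < p := by
    obtain ⟨ω⟩ := ‹Nonempty Ω›
    exact lt_of_lt_of_le (Finset.card_pos.2 ⟨pat ω, Finset.mem_image_of_mem _ (self_mem_agr Z G ω)⟩)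
      (hp ω)
  have hp0' : (0 : ℝ) < p := by exact_mod_cast hp0
  have hq : ∑ ω : Ω, ((agr Z G ω).card : ℝ) / (agr Z (D ∪ G) ω).card ≤ Fintype.card Ω * p := by
    have e1 : ∀ ω : Ω, ((agr Z G ω).card : ℝ) / (agr Z (D ∪ G) ω).card =
        ∑ ω' : Ω, if ω' ∈ agr Z G ω then (1 : ℝ) / (agr Z (D ∪ G) ω).card else 0 := by
      intro ω
      rw [Finset.sum_ite_mem]
      simp only [Finset.univ_inter, Finset.sum_const, nsmul_eq_mul]
      ring
    rw [Finset.sum_congr rfl (fun ω _ => e1 ω), Finset.sum_comm]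
    have e2 : ∀ ω' : Ω, (∑ ω : Ω, if ω' ∈ agr Z G ω then
        (1 : ℝ) / (agr Z (D ∪ G) ω).card else 0) ≤ p := by
      intro ω'
      have hiff : ∀ ω : Ω, ω' ∈ agr Z G ω ↔ ω ∈ agr Z G ω' := by
        intro ω; simp only [mem_agr]
        exact ⟨fun h a ha => (h a ha).symm, fun h a ha => (h a ha).symm⟩
      simp only [hiff, Finset.sum_ite_mem, Finset.univ_inter]
      have e3 : ∑ ω ∈ agr Z G ω', (1 : ℝ) / (agr Z (D ∪ G) ω).card =
          ((agr Z G ω').image pat).card := by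
        rw [← Finset.sum_fiberwise_of_maps_to (t := (agr Z G ω').image pat) (g := pat)
          (fun x hx => Finset.mem_image_of_mem _ hx)]
        have : ∀ b ∈ (agr Z G ω').image pat, ∑ ω ∈ (agr Z G ω').filter (fun x => pat x = b),
            (1 : ℝ) / (agr Z (D ∪ G) ω).card = 1 := by
          intro b hb
          obtain ⟨ω₁, h1, rfl⟩ := Finset.mem_image.1 hb
          have hset : (agr Z G ω').filter (fun x => pat x = pat ω₁) = agr Z (D ∪ G) ω₁ := by
            ext x
            rw [Finset.mem_filter, hpat, ← agr_eq h1]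
            simp only [mem_agr, Finset.mem_union]
            constructor
            · rintro ⟨h1, h2⟩ a (ha | ha)
              exacts [h2 a ha, h1 a ha]
            · intro h
              exact ⟨fun a ha => h a (Or.inr ha), fun a ha => h a (Or.inl ha)⟩
          rw [hset]
          have : ∀ ω ∈ agr Z (D ∪ G) ω₁, (1 : ℝ) / (agr Z (D ∪ G) ω).card =
            1 / (agr Z (D ∪ G) ω₁).card := by
            intro ω hω; rw [agr_eq hω]
          rw [Finset.sum_congr rfl this]
          have := agr_pos Z (D ∪ G) ω₁
          simp only [Finset.sum_const, nsmul_eq_mul]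
          field_simp
        rw [Finset.sum_congr rfl this]
        simp
      rw [e3]
      exact_mod_cast hp ω'
    refine (Finset.sum_le_sum fun a _ => e2 a).trans ?_
    simp
  have h1 : ∀ ω : Ω, Real.log ((Fintype.card Ω : ℝ) / ((agr Z (D ∪ G) ω).card : ℝ)) -
      Real.log ((Fintype.card Ω : ℝ) / ((agr Z G ω).card : ℝ)) ≤
      (((agr Z G ω).card : ℝ) / (agr Z (D ∪ G) ω).card) / p - 1 + Real.log p := by
    intro ω
    have a1 := agr_pos Z (D ∪ G) ω
    have a2 := agr_pos Z G ω
    have := Real.log_le_sub_one_of_pos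
      (x := (((agr Z G ω).card : ℝ) / (agr Z (D ∪ G) ω).card) / p) (by positivity)
    rw [Real.log_div (by positivity) hp0'.ne', Real.log_div a2.ne' a1.ne'] at this
    rw [Real.log_div hcard.ne' a1.ne', Real.log_div hcard.ne' a2.ne']
    linarith
  have h2 := Finset.sum_le_sum (s := Finset.univ) fun ω _ => h1 ω
  simp only [Finset.sum_add_distrib, Finset.sum_sub_distrib, ← Finset.sum_div,
    Finset.sum_const, Finset.card_univ, nsmul_eq_mul, mul_one] at h2
  unfold fent
  rw [← sub_div, div_le_iff₀ hcard]
  have h3 : (∑ ω : Ω, ((agr Z G ω).card : ℝ) / (agr Z (D ∪ G) ω).card) / p ≤ Fintype.card Ω := by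
    rw [div_le_iff₀ hp0']; exact hq
  linarith

end FinEnt
end AsymLY

namespace AsymLY

/-- Translation of a finite set of atoms `(row, time)`. -/
def sh (n : ℤ) (A : Finset (ℕ × ℤ)) : Finset (ℕ × ℤ) :=
  A.image (fun a => (a.1, a.2 + n))

/-- Translation of a set of atoms. -/
def ssh (n : ℤ) (B : Set (ℕ × ℤ)) : Set (ℕ × ℤ) := {a | (a.1, a.2 - n) ∈ B}

lemma mem_sh {n : ℤ} {A : Finset (ℕ × ℤ)} {x : ℕ × ℤ} : x ∈ sh n A ↔ (x.1, x.2 - n) ∈ A := by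
  simp only [sh, Finset.mem_image]
  constructor
  · rintro ⟨a, ha, rfl⟩; simpa using ha
  · intro h; exact ⟨_, h, by simp⟩

lemma mem_ssh {n : ℤ} {A : Set (ℕ × ℤ)} {x : ℕ × ℤ} : x ∈ ssh n A ↔ (x.1, x.2 - n) ∈ A := Iff.rfl

lemma coe_sh (n : ℤ) (A : Finset (ℕ × ℤ)) : (↑(sh n A) : Set (ℕ × ℤ)) = ssh n ↑A := by
  ext x; simp [mem_sh, mem_ssh]

lemma sh_sh (n m : ℤ) (A : Finset (ℕ × ℤ)) : sh n (sh m A) = sh (n + m) A := by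
  ext x; simp only [mem_sh]; rw [show x.2 - n - m = x.2 - (n + m) by ring]

lemma ssh_ssh (n m : ℤ) (A : Set (ℕ × ℤ)) : ssh n (ssh m A) = ssh (n + m) A := by
  ext x; simp only [mem_ssh]; rw [show x.2 - n - m = x.2 - (n + m) by ring]

lemma sh_zero (A : Finset (ℕ × ℤ)) : sh 0 A = A := by ext x; simp [mem_sh]

lemma ssh_zero (A : Set (ℕ × ℤ)) : ssh 0 A = A := by ext x; simp [mem_ssh]

lemma sh_union (n : ℤ) (A B : Finset (ℕ × ℤ)) : sh n (A ∪ B) = sh n A ∪ sh n B := by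
  ext x; simp [mem_sh]

lemma ssh_union (n : ℤ) (A B : Set (ℕ × ℤ)) : ssh n (A ∪ B) = ssh n A ∪ ssh n B := by
  ext x; simp [mem_ssh]

lemma ssh_mono {n : ℤ} {A B : Set (ℕ × ℤ)} (h : A ⊆ B) : ssh n A ⊆ ssh n B := fun _ hx => h hx

/-- A finite set of times in row `0`. -/
def row (W : Finset ℤ) : Finset (ℕ × ℤ) :=
  W.image (fun t => ((0 : ℕ), t))

lemma mem_row {W : Finset ℤ} {x : ℕ × ℤ} : x ∈ row W ↔ x.1 = 0 ∧ x.2 ∈ W := by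
  simp only [row, Finset.mem_image]
  constructor
  · rintro ⟨a, ha, rfl⟩; exact ⟨rfl, ha⟩
  · rintro ⟨h1, h2⟩; exact ⟨_, h2, Prod.ext h1.symm rfl⟩

/-- Shift invariant entropy-like set functions. -/
structure Poly (f : Finset (ℕ × ℤ) → ℝ) (h0 : ℝ) : Prop where
  empty : f ∅ = 0
  mono : ∀ {A B}, A ⊆ B → f A ≤ f B
  submod : ∀ {A B C}, C ⊆ A → C ⊆ B → f (A ∪ B) + f C ≤ f A + f B
  shift : ∀ n A, f (sh n A) = f A
  indep : ∀ W : Finset ℤ, f (row W) = W.card * h0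

/-- Conditional entropy given a possibly infinite set of atoms. -/
noncomputable def cd (f : Finset (ℕ × ℤ) → ℝ) (A : Finset (ℕ × ℤ)) (B : Set (ℕ × ℤ)) : ℝ :=
  ⨅ F : {F : Finset (ℕ × ℤ) // (F : Set (ℕ × ℤ)) ⊆ B}, (f (A ∪ F.1) - f F.1)

section
variable {f : Finset (ℕ × ℤ) → ℝ} {h0 : ℝ}

lemma Poly.nonneg (P : Poly f h0) (A) : 0 ≤ f A := by rw [← P.empty]; exact P.mono (Finset.empty_subset _)

lemma Poly.cond_nonneg (P : Poly f h0) (A F : Finset (ℕ × ℤ)) : 0 ≤ f (A ∪ F) - f F := by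
  have := P.mono (A := F) (B := A ∪ F) Finset.subset_union_right
  linarith

lemma Poly.cond_anti (P : Poly f h0) (A : Finset (ℕ × ℤ)) {F G : Finset (ℕ × ℤ)} (h : F ⊆ G) :
    f (A ∪ G) - f G ≤ f (A ∪ F) - f F := by
  have := P.submod (A := A ∪ F) (B := G) (C := F) Finset.subset_union_right h
  have e : A ∪ F ∪ G = A ∪ G := by
    rw [Finset.union_assoc, Finset.union_eq_right.2 h]
  rw [e] at this
  linarith

lemma cd_le (P : Poly f h0) {A : Finset (ℕ × ℤ)} {B : Set (ℕ × ℤ)} (F : Finset (ℕ × ℤ))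
    (h : (F : Set (ℕ × ℤ)) ⊆ B) : cd f A B ≤ f (A ∪ F) - f F :=
  ciInf_le (f := fun F : {F : Finset (ℕ × ℤ) // (F : Set (ℕ × ℤ)) ⊆ B} => (f (A ∪ F.1) - f F.1))
    ⟨0, by rintro _ ⟨F, rfl⟩; exact P.cond_nonneg _ _⟩ ⟨F, h⟩

lemma le_cd {A : Finset (ℕ × ℤ)} {B : Set (ℕ × ℤ)} {r : ℝ}
    (h : ∀ F : Finset (ℕ × ℤ), (F : Set (ℕ × ℤ)) ⊆ B → r ≤ f (A ∪ F) - f F) : r ≤ cd f A B := by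
  have : Nonempty {F : Finset (ℕ × ℤ) // (F : Set (ℕ × ℤ)) ⊆ B} := ⟨⟨∅, by simp⟩⟩
  exact le_ciInf fun F => h F.1 F.2

lemma exists_cd_lt (A : Finset (ℕ × ℤ)) (B : Set (ℕ × ℤ)) {ε : ℝ} (hε : 0 < ε) :
    ∃ F : Finset (ℕ × ℤ), (F : Set (ℕ × ℤ)) ⊆ B ∧ f (A ∪ F) - f F < cd f A B + ε := by
  by_contra! h
  have := le_cd (f := f) (A := A) (B := B) (r := cd f A B + ε) h
  linarith

lemma cd_nonneg (P : Poly f h0) (A : Finset (ℕ × ℤ)) (B : Set (ℕ × ℤ)) : 0 ≤ cd f A B :=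
  le_cd fun F _ => P.cond_nonneg A F

lemma cd_anti (P : Poly f h0) (A : Finset (ℕ × ℤ)) {B B' : Set (ℕ × ℤ)} (h : B ⊆ B') : cd f A B' ≤ cd f A B :=
  le_cd fun F hF => cd_le P F (hF.trans h)

lemma cd_empty (P : Poly f h0) (A : Finset (ℕ × ℤ)) : cd f A ∅ = f A := by
  apply le_antisymm
  · have := cd_le P (A := A) (B := ∅) ∅ (by simp)
    simpa [P.empty] using this
  · refine le_cd fun F hF => ?_
    have : F = ∅ := by
      rw [← Finset.coe_eq_empty]; exact Set.subset_empty_iff.1 hF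
    simp [this, P.empty]

lemma cd_le_f (P : Poly f h0) (A : Finset (ℕ × ℤ)) (B : Set (ℕ × ℤ)) : cd f A B ≤ f A := by
  rw [← cd_empty P A]; exact cd_anti P A (Set.empty_subset _)

lemma cd_chain (P : Poly f h0) (A A' : Finset (ℕ × ℤ)) (B : Set (ℕ × ℤ)) :
    cd f (A ∪ A') B = cd f A' B + cd f A (↑A' ∪ B) := by
  apply le_antisymm
  · refine le_of_forall_pos_le_add fun ε hε => ?_
    obtain ⟨F1, h1, h1'⟩ := exists_cd_lt (f := f) A' B (half_pos hε)
    obtain ⟨F2, h2, h2'⟩ := exists_cd_lt (f := f) A (↑A' ∪ B) (half_pos hε)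
    set F : Finset (ℕ × ℤ) := F1 ∪ F2.filter (· ∈ B) with hF
    have hFB : (F : Set (ℕ × ℤ)) ⊆ B := by
      intro x hx
      simp only [hF, Finset.coe_union, Finset.coe_filter, Set.mem_union, Finset.mem_coe,
        Set.mem_ofPred_eq] at hx
      rcases hx with hx | hx
      · exact h1 hx
      · exact hx.2
    have hF2 : F2 ⊆ A' ∪ F := by
      intro x hx
      have := h2 (Finset.mem_coe.2 hx)
      simp only [Set.mem_union, Finset.mem_coe] at this
      simp only [hF, Finset.mem_union, Finset.mem_filter]
      tauto
    have a1 := cd_le P (A := A ∪ A') F hFB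
    have a2 := P.cond_anti A' (F := F1) (G := F) Finset.subset_union_left
    have a3 := P.cond_anti A hF2
    rw [Finset.union_assoc] at a1
    linarith
  · refine le_cd fun F hF => ?_
    have a1 := cd_le P (A := A') F hF
    have a2 := cd_le P (A := A) (B := ↑A' ∪ B) (A' ∪ F) (by
      rw [Finset.coe_union]; exact Set.union_subset_union_right _ hF)
    rw [Finset.union_assoc]
    linarith

lemma cd_mono (P : Poly f h0) {A A' : Finset (ℕ × ℤ)} (h : A ⊆ A') (B : Set (ℕ × ℤ)) : cd f A B ≤ cd f A' B := by
  have := cd_chain P A' A B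
  rw [Finset.union_eq_left.2 h] at this
  have := cd_nonneg P A' (↑A ∪ B)
  linarith

lemma cd_shift_le (P : Poly f h0) (n : ℤ) (A : Finset (ℕ × ℤ)) (B : Set (ℕ × ℤ)) :
    cd f (sh n A) (ssh n B) ≤ cd f A B := by
  refine le_cd fun F hF => ?_
  have := cd_le P (A := sh n A) (B := ssh n B) (sh n F) (by rw [coe_sh]; exact ssh_mono hF)
  rwa [← sh_union, P.shift, P.shift] at this

lemma cd_shift (P : Poly f h0) (n : ℤ) (A : Finset (ℕ × ℤ)) (B : Set (ℕ × ℤ)) :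
    cd f (sh n A) (ssh n B) = cd f A B := by
  apply le_antisymm (cd_shift_le P n A B)
  have := cd_shift_le P (-n) (sh n A) (ssh n B)
  rwa [sh_sh, ssh_ssh, neg_add_cancel, sh_zero, ssh_zero] at this

/-- Mutual information is monotone. -/
lemma cd_info_mono (P : Poly f h0) {A A' : Finset (ℕ × ℤ)} (h : A ⊆ A') {B B' : Set (ℕ × ℤ)} (hB : B ⊆ B') :
    cd f A B - cd f A B' ≤ cd f A' B - cd f A' B' := by
  have h1 := cd_chain P A' A B
  have h2 := cd_chain P A' A B'
  rw [Finset.union_eq_left.2 h] at h1 h2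
  have := cd_anti P A' (Set.union_subset_union_right (↑A : Set (ℕ × ℤ)) hB)
  linarith

end

/-- The window `[0,k)` of the process generated by `q`. -/
def seg (q : Finset (ℕ × ℤ)) (k : ℕ) : Finset (ℕ × ℤ) :=
  (Finset.range k).biUnion (fun i => sh i q)

/-- The future `[a,∞)` of the process generated by `q`. -/
def fut (q : Finset (ℕ × ℤ)) (a : ℤ) : Set (ℕ × ℤ) := {x | ∃ i : ℕ, (x.1, x.2 - a - i) ∈ q}

lemma mem_seg {q : Finset (ℕ × ℤ)} {k : ℕ} {x : ℕ × ℤ} :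
    x ∈ seg q k ↔ ∃ i : ℕ, i < k ∧ (x.1, x.2 - i) ∈ q := by
  simp [seg, mem_sh]

lemma mem_fut {q : Finset (ℕ × ℤ)} {a : ℤ} {x : ℕ × ℤ} :
    x ∈ fut q a ↔ ∃ i : ℕ, (x.1, x.2 - a - i) ∈ q := Iff.rfl

lemma seg_zero (q : Finset (ℕ × ℤ)) : seg q 0 = ∅ := by simp [seg]

lemma seg_succ (q : Finset (ℕ × ℤ)) (k : ℕ) : seg q (k + 1) = q ∪ sh 1 (seg q k) := by
  ext x
  simp only [Finset.mem_union, mem_sh, mem_seg]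
  constructor
  · rintro ⟨i, hi, h⟩
    rcases i with _ | i
    · left; simpa using h
    · right; refine ⟨i, by omega, ?_⟩
      rw [show x.2 - 1 - (i : ℤ) = x.2 - ((i + 1 : ℕ) : ℤ) by push_cast; ring]; exact h
  · rintro (h | ⟨i, hi, h⟩)
    · exact ⟨0, by omega, by simpa using h⟩
    · refine ⟨i + 1, by omega, ?_⟩
      rw [show x.2 - ((i + 1 : ℕ) : ℤ) = x.2 - 1 - (i : ℤ) by push_cast; ring]; exact h

lemma ssh_fut (n : ℤ) (q : Finset (ℕ × ℤ)) (a : ℤ) : ssh n (fut q a) = fut q (a + n) := by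
  ext x
  simp only [mem_ssh, mem_fut]
  refine exists_congr fun i => ?_
  rw [show x.2 - n - a - i = x.2 - (a + n) - i by ring]

lemma fut_anti (q : Finset (ℕ × ℤ)) {a b : ℤ} (h : a ≤ b) : fut q b ⊆ fut q a := by
  rintro x ⟨i, hi⟩
  refine ⟨i + (b - a).toNat, ?_⟩
  rw [show x.2 - a - ((i + (b - a).toNat : ℕ) : ℤ) = x.2 - b - i by push_cast; omega]; exact hi

lemma fut_union (q r : Finset (ℕ × ℤ)) (a : ℤ) : fut (q ∪ r) a = fut q a ∪ fut r a := by
  ext x; simp only [mem_fut, Finset.mem_union, Set.mem_union, exists_or]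

lemma seg_union (q r : Finset (ℕ × ℤ)) (k : ℕ) : seg (q ∪ r) k = seg q k ∪ seg r k := by
  ext x; simp only [mem_seg, Finset.mem_union, and_or_left, exists_or]

lemma seg_fut (q : Finset (ℕ × ℤ)) (k : ℕ) :
    (↑(sh 1 (seg q k)) : Set (ℕ × ℤ)) ∪ fut q (k + 1) = fut q 1 := by
  ext x
  simp only [Set.mem_union, Finset.mem_coe, mem_sh, mem_seg, mem_fut]
  constructor
  · rintro (⟨i, _, h⟩ | ⟨i, h⟩)
    · exact ⟨i, h⟩
    · refine ⟨i + k, ?_⟩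
      rw [show x.2 - 1 - ((i + k : ℕ) : ℤ) = x.2 - (k + 1) - i by push_cast; ring]; exact h
  · rintro ⟨i, h⟩
    by_cases hi : i < k
    · exact Or.inl ⟨i, hi, h⟩
    · refine Or.inr ⟨i - k, ?_⟩
      rw [show x.2 - (k + 1) - ((i - k : ℕ) : ℤ) = x.2 - 1 - i by
        push_cast [Nat.cast_sub (not_lt.1 hi)]; ring]
      exact h

section
variable {f : Finset (ℕ × ℤ) → ℝ} {h0 : ℝ}

lemma cd_seg_succ (P : Poly f h0) (q : Finset (ℕ × ℤ)) (k : ℕ) (B : Set (ℕ × ℤ)) :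
    cd f (seg q (k + 1)) (ssh 1 B) = cd f (seg q k) B + cd f q (↑(sh 1 (seg q k)) ∪ ssh 1 B) := by
  rw [seg_succ, cd_chain P, cd_shift P]

lemma cd_seg_fut (P : Poly f h0) (q r : Finset (ℕ × ℤ)) (k : ℕ) :
    cd f (seg q k) (fut q k ∪ fut r k) =
      ∑ i ∈ Finset.range k, cd f q (fut q 1 ∪ fut r (i + 1)) := by
  induction k with
  | zero =>
    rw [seg_zero]
    simp only [Finset.range_zero, Finset.sum_empty]
    refine le_antisymm ?_ (cd_nonneg P _ _)
    rw [← P.empty]; exact cd_le_f P _ _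
  | succ k ih =>
    rw [Finset.sum_range_succ, ← ih]
    have := cd_seg_succ P q k (fut q k ∪ fut r k)
    rw [ssh_union, ssh_fut, ssh_fut, ← Set.union_assoc, seg_fut] at this
    push_cast
    exact this

lemma cd_seg_fut' (P : Poly f h0) (q : Finset (ℕ × ℤ)) (k : ℕ) :
    cd f (seg q k) (fut q k) = k * cd f q (fut q 1) := by
  have := cd_seg_fut P q ∅ k
  simpa [fut] using this

lemma f_seg_ge (P : Poly f h0) (q : Finset (ℕ × ℤ)) (k : ℕ) : k * cd f q (fut q 1) ≤ f (seg q k) := by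
  rw [← cd_seg_fut' P]; exact cd_le_f P _ _

lemma f_seg_le (P : Poly f h0) (p : Finset (ℕ × ℤ)) {ε : ℝ} (hε : 0 < ε) :
    ∃ C : ℝ, ∀ k : ℕ, f (seg p k) ≤ C + k * (cd f p (fut p 1) + ε) := by
  obtain ⟨F, hF, hF'⟩ := exists_cd_lt (f := f) p (fut p 1) hε
  have hM : ∃ M : ℕ, ∀ k ≥ M, F ⊆ sh 1 (seg p k) := by
    have : ∀ x ∈ F, ∃ M : ℕ, ∀ k ≥ M, x ∈ sh 1 (seg p k) := by
      intro x hx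
      obtain ⟨i, hi⟩ := hF (Finset.mem_coe.2 hx)
      refine ⟨i + 1, fun k hk => ?_⟩
      rw [mem_sh, mem_seg]
      exact ⟨i, by omega, hi⟩
    choose! M hM using this
    refine ⟨F.sup M, fun k hk x hx => hM x hx k ((Finset.le_sup hx).trans hk)⟩
  obtain ⟨M, hM⟩ := hM
  have hstep : ∀ k, f (seg p (k + 1)) ≤ f (seg p k) + f p := by
    intro k
    have := cd_seg_succ P p k ∅
    have e : ssh 1 (∅ : Set (ℕ × ℤ)) = ∅ := rfl
    rw [e, cd_empty P, cd_empty P] at this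
    rw [this]
    have := cd_le_f P p (↑(sh 1 (seg p k)) ∪ ∅)
    linarith
  have hstep2 : ∀ k ≥ M, f (seg p (k + 1)) ≤ f (seg p k) + (cd f p (fut p 1) + ε) := by
    intro k hk
    have := cd_seg_succ P p k ∅
    have e : ssh 1 (∅ : Set (ℕ × ℤ)) = ∅ := rfl
    rw [e, cd_empty P, cd_empty P] at this
    rw [this]
    have := cd_le P (A := p) (B := ↑(sh 1 (seg p k)) ∪ ∅) F (by
      intro x hx; left; exact Finset.mem_coe.2 (hM k hk (Finset.mem_coe.1 hx)))
    linarith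
  have hpos : 0 ≤ cd f p (fut p 1) + ε := by have := cd_nonneg P p (fut p 1); linarith
  have hsmall : ∀ k, f (seg p k) ≤ k * f p := by
    intro k
    induction k with
    | zero => simp [seg_zero, P.empty]
    | succ k ih => have := hstep k; push_cast; linarith
  refine ⟨M * f p, fun k => ?_⟩
  induction k with
  | zero =>
    have := mul_nonneg (Nat.cast_nonneg (α := ℝ) M) (P.nonneg p)
    simp [seg_zero, P.empty, this]
  | succ k ih =>
    by_cases hk : M ≤ k
    · have := hstep2 k hk; push_cast; linarith
    · have h1 := hsmall (k + 1)
      have h2 : ((k + 1 : ℕ) : ℝ) * f p ≤ M * f p :=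
        mul_le_mul_of_nonneg_right (by exact_mod_cast (by omega)) (P.nonneg p)
      have h3 : 0 ≤ ((k + 1 : ℕ) : ℝ) * (cd f p (fut p 1) + ε) := by positivity
      linarith

/-- Key mixing lemma. -/
lemma mixing (P : Poly f h0) (q r : Finset (ℕ × ℤ)) {ε : ℝ} (hε : 0 < ε) :
    ∃ k0 : ℕ, ∀ k : ℤ, k0 ≤ k → cd f q (fut q 1) - ε ≤ cd f q (fut q 1 ∪ fut r k) := by
  obtain ⟨C, hC⟩ := f_seg_le P (q ∪ r) (half_pos hε)
  obtain ⟨k0, hk0⟩ := exists_nat_gt (max 0 (C / (ε / 2)))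
  refine ⟨k0, fun k hk => ?_⟩
  refine le_trans ?_ (cd_anti P q (Set.union_subset_union_right _ (fut_anti r hk)))
  have hk0pos : (0 : ℝ) < k0 := lt_of_le_of_lt (le_max_left _ _) hk0
  have hCk : C ≤ k0 * (ε / 2) := by
    have := (le_max_right 0 (C / (ε / 2))).trans hk0.le
    rwa [div_le_iff₀ (half_pos hε)] at this
  have h1 := hC k0
  have h2 := cd_seg_fut' P (q ∪ r) k0
  have h3 := cd_chain P (seg r k0) (seg q k0) (fut (q ∪ r) k0)
  have h3' := cd_chain P (seg r k0) (seg q k0) ∅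
  rw [Finset.union_comm, ← seg_union] at h3 h3'
  rw [cd_empty P, cd_empty P] at h3'
  have h4 := cd_anti P (seg r k0) (B := ↑(seg q k0) ∪ ∅) (B' := ↑(seg q k0) ∪ fut (q ∪ r) k0)
    (Set.union_subset_union_right _ (Set.empty_subset _))
  have h5 := f_seg_ge P q k0
  have h6 := cd_seg_fut P q r k0
  rw [← fut_union] at h6
  have h7 : ∑ i ∈ Finset.range k0, cd f q (fut q 1 ∪ fut r (i + 1)) ≤
      k0 * cd f q (fut q 1 ∪ fut r k0) := by
    have : ∀ i ∈ Finset.range k0, cd f q (fut q 1 ∪ fut r (i + 1)) ≤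
        cd f q (fut q 1 ∪ fut r k0) := by
      intro i hi
      refine cd_anti P q (Set.union_subset_union_right _ (fut_anti r ?_))
      have := Finset.mem_range.1 hi; omega
    simpa using Finset.sum_le_sum this
  have h8 : (k0 : ℝ) * (cd f q (fut q 1) - ε) ≤ k0 * cd f q (fut q 1 ∪ fut r k0) := by
    nlinarith
  exact le_of_mul_le_mul_left h8 hk0pos

end
end AsymLY

namespace AsymLY

/-- Dependent choice with a local invariant. -/
lemma dep_choice {α : Type*} [Inhabited α] (Inv : ℕ → (ℕ → α) → Prop)
    (h0 : Inv 0 (fun _ => default))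
    (hs : ∀ n s, Inv n s → ∃ a, Inv (n + 1) (Function.update s n a))
    (hloc : ∀ n s s', (∀ i < n, s i = s' i) → Inv n s → Inv n s') : ∃ s, ∀ n, Inv n s := by
  choose! c hc using hs
  let g : ℕ → (ℕ → α) := fun n => Nat.rec (fun _ => default)
    (fun n f => Function.update f n (c n f)) n
  have gs : ∀ n, g (n + 1) = Function.update (g n) n (c n (g n)) := fun n => rfl
  have hI : ∀ n, Inv n (g n) := by
    intro n
    induction n with
    | zero => exact h0
    | succ n ih => rw [gs]; exact hc n _ ih
  have hst : ∀ i n, i < n → g n i = g (i + 1) i := by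
    intro i n h
    induction n with
    | zero => omega
    | succ n ih =>
      rcases Nat.lt_succ_iff_lt_or_eq.1 h with h | h
      · rw [gs, Function.update_of_ne (by omega), ih h]
      · rw [h]
  exact ⟨fun i => g (i + 1) i, fun n => hloc n (g n) _ (fun i hi => hst i n hi) (hI n)⟩

/-- The origin atom. -/
def oo : Finset (ℕ × ℤ) := row {0}

lemma mem_oo {x : ℕ × ℤ} : x ∈ oo ↔ x.1 = 0 ∧ x.2 = 0 := by simp [oo, mem_row]

lemma mem_fut_oo {a : ℤ} {x : ℕ × ℤ} : x ∈ fut oo a ↔ x.1 = 0 ∧ a ≤ x.2 := by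
  simp only [mem_fut, mem_oo]
  constructor
  · rintro ⟨i, h1, h2⟩; exact ⟨h1, by omega⟩
  · rintro ⟨h1, h2⟩; exact ⟨(x.2 - a).toNat, h1, by omega⟩

/-- Future with delays, first `J` rows. -/
def Fs (k : ℕ → ℕ) (J : ℕ) (m : ℕ) : Set (ℕ × ℤ) :=
  {x | (x.1 = 0 ∧ 1 ≤ x.2) ∨ ∃ j < J, x.1 = j + 1 ∧ (k j : ℤ) + m + 1 ≤ x.2}

/-- Future with delays, all rows. -/
def Fi (k : ℕ → ℕ) : Set (ℕ × ℤ) :=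
  {x | (x.1 = 0 ∧ 0 ≤ x.2) ∨ ∃ j, x.1 = j + 1 ∧ (k j : ℤ) ≤ x.2}

/-- The finite generator of `Fs`. -/
def qg (k : ℕ → ℕ) (J : ℕ) (m : ℕ) : Finset (ℕ × ℤ) :=
  oo ∪ (Finset.range J).image (fun j => (j + 1, (k j : ℤ) + m))

lemma fut_qg (k : ℕ → ℕ) (J m : ℕ) : fut (qg k J m) 1 = Fs k J m := by
  ext x
  simp only [qg, fut_union, Set.mem_union, mem_fut_oo]
  simp only [Fs, Set.mem_ofPred_eq, mem_fut, Finset.mem_image, Finset.mem_range, Prod.mk.injEq]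
  refine or_congr Iff.rfl ?_
  constructor
  · rintro ⟨i, j, hj, h1, h2⟩; exact ⟨j, hj, h1.symm, by omega⟩
  · rintro ⟨j, hj, h1, h2⟩
    exact ⟨(x.2 - 1 - (k j + m)).toNat, j, hj, h1.symm, by omega⟩

lemma Fs_congr {k k' : ℕ → ℕ} {J m : ℕ} (h : ∀ j < J, k j = k' j) : Fs k J m = Fs k' J m := by
  ext x
  simp only [Fs, Set.mem_ofPred_eq]
  refine or_congr Iff.rfl (exists_congr fun j => ?_)
  constructor
  · rintro ⟨a, b, c⟩; exact ⟨a, b, by rw [← h j a]; exact c⟩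
  · rintro ⟨a, b, c⟩; exact ⟨a, b, by rw [h j a]; exact c⟩

lemma fut_rr {J : ℕ} {a : ℤ} {x : ℕ × ℤ} :
    x ∈ fut ((Finset.range J).image (fun j => (j + 1, (0 : ℤ)))) a ↔
      ∃ j < J, x.1 = j + 1 ∧ a ≤ x.2 := by
  simp only [mem_fut, Finset.mem_image, Finset.mem_range, Prod.mk.injEq]
  constructor
  · rintro ⟨i, j, hj, h1, h2⟩; exact ⟨j, hj, h1.symm, by omega⟩
  · rintro ⟨j, hj, h1, h2⟩; exact ⟨(x.2 - a).toNat, j, hj, h1.symm, by omega⟩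

section
variable {f : Finset (ℕ × ℤ) → ℝ} {h0 : ℝ}

lemma cd_row_eq (P : Poly f h0) (W : Finset ℤ) (B : Set (ℕ × ℤ))
    (hB : ∀ x ∈ B, x.1 = 0 ∧ x.2 ∉ W) : cd f (row W) B = W.card * h0 := by
  apply le_antisymm
  · rw [← P.indep]; exact cd_le_f P _ _
  · refine le_cd fun F hF => ?_
    have e : F = row (F.image Prod.snd) := by
      ext ⟨a, b⟩
      simp only [mem_row, Finset.mem_image, Prod.exists, exists_eq_right]
      constructor
      · intro h; exact ⟨(hB _ (hF h)).1, a, h⟩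
      · rintro ⟨h1, a', h2⟩
        have := (hB _ (hF h2)).1
        simp only at this h1
        rw [h1, ← this]; exact h2
    have hd : Disjoint W (F.image Prod.snd) := by
      rw [Finset.disjoint_left]
      intro t ht ht'
      obtain ⟨x, hx, rfl⟩ := Finset.mem_image.1 ht'
      exact (hB _ (hF hx)).2 ht
    have e2 : row W ∪ row (F.image Prod.snd) = row (W ∪ F.image Prod.snd) := by
      ext x; simp only [Finset.mem_union, mem_row]; tauto
    rw [e, e2, P.indep, P.indep, Finset.card_union_of_disjoint hd]
    push_cast; linarith

lemma cd_oo (P : Poly f h0) : cd f oo (fut oo 1) = h0 := by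
  have := cd_row_eq P {0} (fut oo 1) (by
    intro x hx; rw [mem_fut_oo] at hx; refine ⟨hx.1, ?_⟩
    rw [Finset.mem_singleton]; omega)
  simpa [oo] using this

lemma cd_oo_le (P : Poly f h0) (B : Set (ℕ × ℤ)) : cd f oo B ≤ h0 := by
  refine (cd_le_f P _ _).trans ?_
  rw [oo, P.indep]; simp

lemma Fs_far (P : Poly f h0) (J : ℕ) {ε : ℝ} (hε : 0 < ε) :
    ∃ m0 : ℕ, ∀ k : ℕ → ℕ, ∀ m ≥ m0, h0 - ε ≤ cd f oo (Fs k J m) := by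
  obtain ⟨k0, hk0⟩ := mixing P oo ((Finset.range J).image (fun j => (j + 1, (0 : ℤ)))) hε
  refine ⟨k0, fun k m hm => ?_⟩
  have := hk0 k0 le_rfl
  rw [cd_oo P] at this
  refine this.trans (cd_anti P _ ?_)
  rintro x (hx | ⟨j, hj, h1, h2⟩)
  · exact Or.inl (mem_fut_oo.2 hx)
  · exact Or.inr (fut_rr.2 ⟨j, hj, h1, by omega⟩)

lemma delay_step (P : Poly f h0) (k : ℕ → ℕ) (J : ℕ) {ε : ℝ} (hε : 0 < ε) :
    ∃ K : ℕ, ∀ m : ℕ, cd f oo (Fs k J m) - ε ≤ cd f oo (Fs (Function.update k J K) (J + 1) m) := by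
  obtain ⟨m0, hm0⟩ := Fs_far P (J + 1) hε
  have : ∀ m : ℕ, ∃ k0 : ℕ, ∀ k' : ℤ, k0 ≤ k' → cd f (qg k J m) (fut (qg k J m) 1) - ε ≤
      cd f (qg k J m) (fut (qg k J m) 1 ∪ fut {(J + 1, (0 : ℤ))} k') := fun m =>
    mixing P (qg k J m) {(J + 1, (0 : ℤ))} hε
  choose k0 hk0 using this
  refine ⟨(Finset.range m0).sup k0, fun m => ?_⟩
  by_cases hm : m0 ≤ m
  · have := hm0 (Function.update k J ((Finset.range m0).sup k0)) m hm
    have := cd_oo_le P (Fs k J m)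
    linarith
  · have h1 : k0 m ≤ (Finset.range m0).sup k0 := Finset.le_sup (Finset.mem_range.2 (by omega))
    set K := (Finset.range m0).sup k0
    have h2 := hk0 m (K + m + 1) (by omega)
    have h3 := cd_info_mono P (A := oo) (A' := qg k J m) Finset.subset_union_left
      (B := fut (qg k J m) 1) (B' := fut (qg k J m) 1 ∪ fut {(J + 1, (0 : ℤ))} (K + m + 1))
      Set.subset_union_left
    have h4 : Fs (Function.update k J K) (J + 1) m ⊆
        fut (qg k J m) 1 ∪ fut {(J + 1, (0 : ℤ))} (K + m + 1) := by
      rw [fut_qg]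
      rintro x (hx | ⟨j, hj, h5, h6⟩)
      · exact Or.inl (Or.inl hx)
      · by_cases hjJ : j = J
        · subst hjJ
          rw [Function.update_self] at h6
          right
          rw [mem_fut]
          refine ⟨(x.2 - (K + m + 1)).toNat, ?_⟩
          rw [Finset.mem_singleton, Prod.mk.injEq]
          exact ⟨h5, by omega⟩
        · rw [Function.update_of_ne hjJ] at h6
          exact Or.inl (Or.inr ⟨j, by omega, h5, h6⟩)
    have h7 := cd_anti P oo h4
    rw [fut_qg] at h2 h3 h7
    linarith

lemma delays (P : Poly f h0) : ∃ k : ℕ → ℕ, ∀ J m : ℕ,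
    cd f oo (Fs k J m) - (1 / 2 : ℝ) ^ J ≤ cd f oo (Fs k (J + 1) m) := by
  obtain ⟨k, hk⟩ := dep_choice (α := ℕ) (fun n k => ∀ J < n, ∀ m : ℕ,
    cd f oo (Fs k J m) - (1 / 2 : ℝ) ^ J ≤ cd f oo (Fs k (J + 1) m))
    (by intro J hJ; omega)
    (by
      intro n s hs
      obtain ⟨K, hK⟩ := delay_step P s n (ε := (1 / 2 : ℝ) ^ n) (by positivity)
      refine ⟨K, fun J hJ m => ?_⟩
      rcases Nat.lt_succ_iff_lt_or_eq.1 hJ with h | h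
      · rw [Fs_congr (k := Function.update s n K) (k' := s)
          (fun j hj => Function.update_of_ne (by omega) _ _),
          Fs_congr (k := Function.update s n K) (k' := s)
          (fun j hj => Function.update_of_ne (by omega) _ _)]
        exact hs J h m
      · subst h
        rw [Fs_congr (k := Function.update s J K) (k' := s) (J := J)
          (fun j hj => Function.update_of_ne (by omega) _ _)]
        exact hK m)
    (by
      intro n s s' h hs J hJ m
      rw [Fs_congr (k := s') (k' := s) (J := J) (fun j hj => (h j (by omega)).symm),
        Fs_congr (k := s') (k' := s) (J := J + 1) (fun j hj => (h j (by omega)).symm)]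
      exact hs J hJ m)
  exact ⟨k, fun J m => hk (J + 1) J (by omega) m⟩

lemma Fi_far (P : Poly f h0) {k : ℕ → ℕ} (hk : ∀ J m : ℕ,
    cd f oo (Fs k J m) - (1 / 2 : ℝ) ^ J ≤ cd f oo (Fs k (J + 1) m)) {ε : ℝ} (hε : 0 < ε) :
    ∃ m0 : ℕ, ∀ m : ℕ, m0 ≤ m → h0 - ε ≤ cd f oo (fut oo 1 ∪ ssh (m + 1) (Fi k)) := by
  obtain ⟨J0, hJ0⟩ := exists_pow_lt_of_lt_one (show (0 : ℝ) < ε / 4 by positivity)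
    (show (1 / 2 : ℝ) < 1 by norm_num)
  obtain ⟨m0, hm0⟩ := Fs_far P J0 (half_pos hε)
  refine ⟨m0, fun m hm => ?_⟩
  have h1 : ∀ i, h0 - ε / 2 - 2 * ((1 / 2 : ℝ) ^ J0 - (1 / 2 : ℝ) ^ (J0 + i)) ≤
      cd f oo (Fs k (J0 + i) m) := by
    intro i
    induction i with
    | zero => simpa using hm0 k m hm
    | succ i ih =>
      have := hk (J0 + i) m
      rw [← add_assoc, pow_succ]
      linarith
  have h2 : ∀ J ≥ J0, h0 - ε ≤ cd f oo (Fs k J m) := by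
    intro J hJ
    obtain ⟨i, rfl⟩ := Nat.exists_eq_add_of_le hJ
    have := h1 i
    have : (0 : ℝ) < (1 / 2 : ℝ) ^ (J0 + i) := by positivity
    linarith
  refine le_cd fun F hF => ?_
  have h3 : ∃ J, ∀ x ∈ F, x.1 ≤ J := ⟨F.sup Prod.fst, fun x hx => Finset.le_sup (f := Prod.fst) hx⟩
  obtain ⟨J, hJ⟩ := h3
  refine (h2 (max J J0) (le_max_right _ _)).trans (cd_le P F ?_)
  intro x hx
  rcases hF hx with h | h
  · exact Or.inl (mem_fut_oo.1 h)
  · rcases h with h | ⟨j, h, h'⟩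
    · exact Or.inl ⟨h.1, by have := h.2; simp only at this; omega⟩
    · refine Or.inr ⟨j, ?_, h, ?_⟩
      · have := hJ x hx
        simp only at h
        have := le_max_left J J0
        omega
      · simp only at h'; omega

lemma Fi_seg (P : Poly f h0) {k : ℕ → ℕ} (hk : ∀ J m : ℕ,
    cd f oo (Fs k J m) - (1 / 2 : ℝ) ^ J ≤ cd f oo (Fs k (J + 1) m)) {ε : ℝ} (hε : 0 < ε) :
    ∃ m0 : ℕ, ∀ L : ℕ, ∀ n : ℕ, m0 + L + 1 ≤ n →
      L * (h0 - ε) ≤ cd f (seg oo L) (ssh n (Fi k)) := by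
  obtain ⟨m0, hm0⟩ := Fi_far P hk hε
  refine ⟨m0, fun L => ?_⟩
  induction L with
  | zero => intro n _; simpa using cd_nonneg P _ _
  | succ L ih =>
    intro n hn
    obtain ⟨n, rfl⟩ : ∃ n', n = n' + 1 := ⟨n - 1, by omega⟩
    have h1 := ih n (by omega)
    have h2 := hm0 n (by omega)
    have h3 := cd_seg_succ P oo L (ssh n (Fi k))
    rw [ssh_ssh] at h3
    have h4 := cd_anti P oo (B := ↑(sh 1 (seg oo L)) ∪ ssh (1 + (n : ℤ)) (Fi k))
      (B' := fut oo 1 ∪ ssh ((n : ℤ) + 1) (Fi k)) (by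
        rw [add_comm (1 : ℤ)]
        refine Set.union_subset_union_left _ ?_
        rw [← seg_fut oo L]; exact Set.subset_union_left)
    push_cast
    rw [add_comm (n : ℤ) 1] at *
    rw [h3]
    linarith

lemma ssh_Fi_sub (k : ℕ → ℕ) {a b : ℤ} (h : a ≤ b) : ssh b (Fi k) ⊆ ssh a (Fi k) := by
  rintro x (⟨h1, h2⟩ | ⟨j, h1, h2⟩)
  · exact Or.inl ⟨h1, by simp only at *; omega⟩
  · exact Or.inr ⟨j, h1, by simp only at *; omega⟩

lemma fin_sub_Fi (k : ℕ → ℕ) (Λ : Finset (ℕ × ℤ)) : ∃ m : ℕ, (Λ : Set (ℕ × ℤ)) ⊆ ssh (-m) (Fi k) := by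
  have : ∀ x ∈ Λ, ∃ m : ℕ, x ∈ ssh (-m) (Fi k) := by
    rintro ⟨j, t⟩ -
    rcases j with _ | j
    · exact ⟨t.natAbs, Or.inl ⟨rfl, by simp only; omega⟩⟩
    · exact ⟨(-t).toNat + k j, Or.inr ⟨j, rfl, by simp only; omega⟩⟩
  choose! m hm using this
  refine ⟨Λ.sup m, fun x hx => ssh_Fi_sub k ?_ (hm x hx)⟩
  have : m x ≤ Λ.sup m := Finset.le_sup hx
  omega

lemma far_step (P : Poly f h0) (k : ℕ → ℕ) (v Λ : Finset (ℕ × ℤ)) {ε : ℝ} (hε : 0 < ε) :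
    ∃ n0 : ℕ, ∀ n : ℕ, n0 ≤ n →
      cd f (sh (-n) v) (Fi k) - ε ≤ cd f (sh (-n) v) (Fi k ∪ ↑Λ) := by
  obtain ⟨m, hm⟩ := fin_sub_Fi k Λ
  have hb : BddAbove (Set.range fun n : ℕ => cd f v (ssh n (Fi k))) :=
    ⟨f v, by rintro _ ⟨n, rfl⟩; exact cd_le_f P _ _⟩
  obtain ⟨n1, hn1⟩ := exists_lt_of_lt_ciSup
    (show (⨆ n : ℕ, cd f v (ssh n (Fi k))) - ε < ⨆ n : ℕ, cd f v (ssh n (Fi k)) by linarith)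
  refine ⟨n1 + m, fun n hn => ?_⟩
  have e1 : cd f (sh (-n) v) (Fi k) = cd f v (ssh n (Fi k)) := by
    have := cd_shift P (-n) v (ssh n (Fi k))
    rwa [ssh_ssh, neg_add_cancel, ssh_zero] at this
  have e2 : cd f (sh (-n) v) (ssh (-m) (Fi k)) = cd f v (ssh ((n : ℤ) - m) (Fi k)) := by
    have := cd_shift P (-n) v (ssh ((n : ℤ) - m) (Fi k))
    rwa [ssh_ssh, show -(n : ℤ) + (n - m) = -m by ring] at this
  have h1 : cd f v (ssh n1 (Fi k)) ≤ cd f v (ssh ((n : ℤ) - m) (Fi k)) :=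
    cd_anti P v (ssh_Fi_sub k (by omega))
  have h2 := le_ciSup hb n
  have h3 : cd f (sh (-n) v) (ssh (-m) (Fi k)) ≤ cd f (sh (-n) v) (Fi k ∪ ↑Λ) := by
    refine cd_anti P _ (Set.union_subset ?_ hm)
    have := ssh_Fi_sub k (a := -m) (b := 0) (by omega)
    rwa [ssh_zero] at this
  linarith

lemma sh_seg_oo (n L : ℕ) :
    sh (-n) (seg oo L) = row (Finset.Ico (-(n : ℤ)) (-(n : ℤ) + L)) := by
  ext x
  simp only [mem_sh, mem_seg, mem_oo, mem_row, Finset.mem_Ico]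
  constructor
  · rintro ⟨i, hi, h1, h2⟩; exact ⟨h1, by omega, by omega⟩
  · rintro ⟨h1, h2, h3⟩; exact ⟨(x.2 + n).toNat, by omega, h1, by omega⟩

lemma row_union (W B : Finset ℤ) : row (W ∪ B) = row W ∪ row B := by
  ext x; simp only [Finset.mem_union, mem_row]; tauto

/-- One closeness time and one block are added. -/
lemma add_step (P : Poly f h0) {k : ℕ → ℕ} (hk : ∀ J m : ℕ,
    cd f oo (Fs k J m) - (1 / 2 : ℝ) ^ J ≤ cd f oo (Fs k (J + 1) m))
    (W : Finset ℤ) (Y : Finset (ℕ × ℤ)) (j L N : ℕ) {ε : ℝ} (hε : 0 < ε) :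
    ∃ l m : ℕ, N ≤ l ∧ N ≤ m ∧
      cd f (row W) (Fi k ∪ ↑Y) + L * h0 - ε ≤
      cd f (row (W ∪ Finset.Ico (-(m : ℤ)) (-(m : ℤ) + L)))
        (Fi k ∪ ↑(Y ∪ {(j + 1, -(l : ℤ))})) := by
  obtain ⟨n1, hn1⟩ := far_step P k {(j + 1, (0 : ℤ))} (Y ∪ row W) (show 0 < ε / 3 by positivity)
  set l := max n1 N with hl
  have hy := hn1 l (le_max_left _ _)
  have ey : sh (-(l : ℤ)) {(j + 1, (0 : ℤ))} = {(j + 1, -(l : ℤ))} := by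
    ext ⟨a, b⟩
    simp only [mem_sh, Finset.mem_singleton, Prod.mk.injEq]
    omega
  rw [ey] at hy
  set y : Finset (ℕ × ℤ) := {(j + 1, -(l : ℤ))} with hydef
  have hLpos : (0 : ℝ) < L + 1 := by positivity
  obtain ⟨n2, hn2⟩ := far_step P k (seg oo L) ((Y ∪ y) ∪ row W) (show 0 < ε / 3 by positivity)
  obtain ⟨m0, hm0⟩ := Fi_seg P hk (show 0 < ε / 3 / (L + 1) by positivity)
  set m := max (max n2 N) (m0 + L + 1) with hm
  have hm1 : n2 ≤ m := (le_max_left _ _).trans (le_max_left _ _)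
  have hm2 : N ≤ m := (le_max_right _ _).trans (le_max_left _ _)
  have hm3 : m0 + L + 1 ≤ m := le_max_right _ _
  refine ⟨l, m, le_max_right _ _, hm2, ?_⟩
  have hB := hn2 m hm1
  have hB2 := hm0 L m hm3
  have e1 : cd f (sh (-m) (seg oo L)) (Fi k) = cd f (seg oo L) (ssh m (Fi k)) := by
    have := cd_shift P (-m) (seg oo L) (ssh m (Fi k))
    rwa [ssh_ssh, neg_add_cancel, ssh_zero] at this
  rw [e1, sh_seg_oo] at hB
  set B := Finset.Ico (-(m : ℤ)) (-(m : ℤ) + L)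
  have c1 := cd_chain P (row W) y (Fi k ∪ ↑Y)
  have c2 := cd_chain P y (row W) (Fi k ∪ ↑Y)
  rw [Finset.union_comm] at c2
  have c3 := cd_anti P y (B := Fi k) (B' := Fi k ∪ ↑Y) Set.subset_union_left
  have s1 : (↑(row W) : Set (ℕ × ℤ)) ∪ (Fi k ∪ ↑Y) = Fi k ∪ ↑(Y ∪ row W) := by
    rw [Finset.coe_union]; ext x; simp only [Set.mem_union]; tauto
  have s2 : (↑y : Set (ℕ × ℤ)) ∪ (Fi k ∪ ↑Y) = Fi k ∪ ↑(Y ∪ y) := by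
    rw [Finset.coe_union]; ext x; simp only [Set.mem_union]; tauto
  rw [s2] at c1
  rw [s1] at c2
  have c4 := cd_chain P (row B) (row W) (Fi k ∪ ↑(Y ∪ y))
  have s3 : (↑(row W) : Set (ℕ × ℤ)) ∪ (Fi k ∪ ↑(Y ∪ y)) = Fi k ∪ ↑((Y ∪ y) ∪ row W) := by
    rw [Finset.coe_union (Y ∪ y)]; ext x; simp only [Set.mem_union]; tauto
  rw [s3] at c4
  rw [row_union, Finset.union_comm, c4]
  have hq : (L : ℝ) * (ε / 3 / (L + 1)) ≤ ε / 3 := by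
    rw [mul_div_assoc', div_le_iff₀ hLpos]; nlinarith
  linarith

/-- The combinatorial output of the entropy argument. -/
theorem abstract_times (P : Poly f h0) (L : ℕ → ℕ) {ε : ℝ} (hε : 0 < ε) :
    ∃ k l m : ℕ → ℕ, (∀ i, i ≤ l i) ∧ (∀ i, L i + i + 1 ≤ m i) ∧
      (∀ i i', i' < i → m i' + L i ≤ m i) ∧
      ∀ r : ℕ, ∀ F' : Finset (ℕ × ℤ), (F' : Set (ℕ × ℤ)) ⊆ Fi k →
        f (row ((Finset.range r).biUnion fun i => Finset.Ico (-(m i : ℤ)) (-(m i : ℤ) + L i))) +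
        f (F' ∪ (Finset.range r).image (fun j => (j + 1, -(l j : ℤ)))) -
        f (row ((Finset.range r).biUnion fun i => Finset.Ico (-(m i : ℤ)) (-(m i : ℤ) + L i)) ∪
          (F' ∪ (Finset.range r).image (fun j => (j + 1, -(l j : ℤ))))) ≤ ε := by
  obtain ⟨k, hk⟩ := delays P
  obtain ⟨s, hs⟩ := dep_choice (α := ℕ × ℕ) (fun n s =>
    (∀ i < n, i ≤ (s i).1) ∧ (∀ i < n, L i + i + 1 ≤ (s i).2) ∧
    (∀ i < n, ∀ i' < i, (s i').2 + L i ≤ (s i).2) ∧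
    (f (row ((Finset.range n).biUnion fun i =>
      Finset.Ico (-((s i).2 : ℤ)) (-((s i).2 : ℤ) + L i))) - ε * (1 - (1 / 2 : ℝ) ^ n) ≤
      cd f (row ((Finset.range n).biUnion fun i =>
        Finset.Ico (-((s i).2 : ℤ)) (-((s i).2 : ℤ) + L i)))
      (Fi k ∪ ↑((Finset.range n).image (fun j => (j + 1, -((s j).1 : ℤ)))))))
    (by
      refine ⟨by intro i hi; omega, by intro i hi; omega, by intro i hi; omega, ?_⟩
      have : row ∅ = ∅ := rfl
      simp [this, P.empty, cd_nonneg P])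
    (by
      rintro n s ⟨h1, h2, h3, h4⟩
      obtain ⟨l, m, hl, hm, h5⟩ := add_step P hk ((Finset.range n).biUnion fun i =>
        Finset.Ico (-((s i).2 : ℤ)) (-((s i).2 : ℤ) + L i))
        ((Finset.range n).image (fun j => (j + 1, -((s j).1 : ℤ)))) n (L n)
        (L n + n + 1 + (Finset.range n).sup (fun i => (s i).2))
        (ε := ε * (1 / 2 : ℝ) ^ (n + 1)) (by positivity)
      have hsup : ∀ i < n, (s i).2 ≤ (Finset.range n).sup (fun i => (s i).2) := fun i hi =>
        Finset.le_sup (f := fun i => (s i).2) (Finset.mem_range.2 hi)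
      refine ⟨(l, m), ?_, ?_, ?_, ?_⟩
      · intro i hi
        rcases Nat.lt_succ_iff_lt_or_eq.1 hi with h | h
        · rw [Function.update_of_ne (by omega)]; exact h1 i h
        · subst h; rw [Function.update_self]; simp only; omega
      · intro i hi
        rcases Nat.lt_succ_iff_lt_or_eq.1 hi with h | h
        · rw [Function.update_of_ne (by omega)]; exact h2 i h
        · subst h; rw [Function.update_self]; simp only; omega
      · intro i hi i' hi'
        rw [Function.update_of_ne (a := i') (by omega)]
        rcases Nat.lt_succ_iff_lt_or_eq.1 hi with h | h
        · rw [Function.update_of_ne (by omega)]; exact h3 i h i' hi'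
        · subst h; rw [Function.update_self]; have := hsup i' hi'; simp only; omega
      · have eW : ((Finset.range (n + 1)).biUnion fun i =>
            Finset.Ico (-((Function.update s n (l, m) i).2 : ℤ))
              (-((Function.update s n (l, m) i).2 : ℤ) + L i)) =
            ((Finset.range n).biUnion fun i =>
              Finset.Ico (-((s i).2 : ℤ)) (-((s i).2 : ℤ) + L i)) ∪
            Finset.Ico (-(m : ℤ)) (-(m : ℤ) + L n) := by
          rw [Finset.range_add_one, Finset.biUnion_insert, Function.update_self, Finset.union_comm]
          congr 1
          refine Finset.biUnion_congr rfl fun i hi => ?_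
          rw [Function.update_of_ne (by have := Finset.mem_range.1 hi; omega)]
        have eY : ((Finset.range (n + 1)).image
            (fun j => (j + 1, -((Function.update s n (l, m) j).1 : ℤ)))) =
            (Finset.range n).image (fun j => (j + 1, -((s j).1 : ℤ))) ∪ {(n + 1, -(l : ℤ))} := by
          rw [Finset.range_add_one, Finset.image_insert, Function.update_self, Finset.insert_eq,
            Finset.union_comm]
          congr 1
          refine Finset.image_congr fun i hi => ?_
          have := Finset.mem_range.1 (Finset.mem_coe.1 hi)
          rw [Function.update_of_ne (by omega)]
        rw [eW, eY]
        refine le_trans ?_ h5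
        rw [P.indep] at h4 ⊢
        rw [Finset.card_union_of_disjoint, Int.card_Ico]
        · have : (-(m : ℤ) + L n - -(m : ℤ)).toNat = L n := by omega
          rw [this]
          rw [Nat.cast_add, pow_succ]
          linarith
        · rw [Finset.disjoint_left]
          intro t ht ht'
          obtain ⟨i, hi, ht⟩ := Finset.mem_biUnion.1 ht
          have := hsup i (Finset.mem_range.1 hi)
          rw [Finset.mem_Ico] at ht ht'
          omega)
    (by
      rintro n s s' h ⟨h1, h2, h3, h4⟩
      have eW : ((Finset.range n).biUnion fun i =>
            Finset.Ico (-((s' i).2 : ℤ)) (-((s' i).2 : ℤ) + L i)) =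
            ((Finset.range n).biUnion fun i =>
            Finset.Ico (-((s i).2 : ℤ)) (-((s i).2 : ℤ) + L i)) :=
        Finset.biUnion_congr rfl fun i hi => by rw [h i (Finset.mem_range.1 hi)]
      have eY : (Finset.range n).image (fun j => (j + 1, -((s' j).1 : ℤ))) =
          (Finset.range n).image (fun j => (j + 1, -((s j).1 : ℤ))) :=
        Finset.image_congr fun i hi => by
          rw [h i (Finset.mem_range.1 (Finset.mem_coe.1 hi))]
      refine ⟨fun i hi => ?_, fun i hi => ?_, fun i hi i' hi' => ?_, ?_⟩
      · rw [← h i hi]; exact h1 i hi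
      · rw [← h i hi]; exact h2 i hi
      · rw [← h i hi, ← h i' (by omega)]; exact h3 i hi i' hi'
      · rw [eW, eY]; exact h4)
  refine ⟨k, fun i => (s i).1, fun i => (s i).2, fun i => (hs (i + 1)).1 i (by omega),
    fun i => (hs (i + 1)).2.1 i (by omega), fun i => (hs (i + 1)).2.2.1 i (by omega), ?_⟩
  intro r F' hF'
  have h1 := (hs r).2.2.2
  have h2 := cd_le P (A := row ((Finset.range r).biUnion fun i =>
        Finset.Ico (-((s i).2 : ℤ)) (-((s i).2 : ℤ) + L i)))
      (B := Fi k ∪ ↑((Finset.range r).image (fun j => (j + 1, -((s j).1 : ℤ)))))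
      (F' ∪ (Finset.range r).image (fun j => (j + 1, -((s j).1 : ℤ)))) (by
        rw [Finset.coe_union]; exact Set.union_subset_union_left _ hF')
  have h3 : (0 : ℝ) < (1 / 2 : ℝ) ^ r := by positivity
  have h4 : 0 < ε * (1 / 2 : ℝ) ^ r := mul_pos hε h3
  linarith

end
end AsymLY

namespace AsymLY

/-- Sets shattered by a family of partial binary sequences. -/
noncomputable def shat (n : ℕ) (S : Set (ℕ → Option Bool)) : Finset (Finset ℕ) :=
  (Finset.range n).powerset.filter (fun J => ∀ σ : ℕ → Bool, ∃ s ∈ S, ∀ i ∈ J, s i = some (σ i))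

lemma mem_shat {n : ℕ} {S : Set (ℕ → Option Bool)} {J : Finset ℕ} :
    J ∈ shat n S ↔ J ⊆ Finset.range n ∧
      ∀ σ : ℕ → Bool, ∃ s ∈ S, ∀ i ∈ J, s i = some (σ i) := by
  simp only [shat, Finset.mem_filter, Finset.mem_powerset]

lemma shat_mono {n n' : ℕ} (hn : n ≤ n') {S S' : Set (ℕ → Option Bool)} (h : S ⊆ S') :
    shat n S ⊆ shat n' S' := by
  intro J hJ
  rw [mem_shat] at *
  refine ⟨hJ.1.trans (Finset.range_mono hn), fun σ => ?_⟩
  obtain ⟨s, hs, h'⟩ := hJ.2 σ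
  exact ⟨s, h hs, h'⟩

lemma shat_add (n : ℕ) (S : Set (ℕ → Option Bool)) :
    (shat n {s ∈ S | s n = some false}).card + (shat n {s ∈ S | s n = some true}).card ≤
      (shat (n + 1) S).card := by
  set A := shat n {s ∈ S | s n = some false}
  set B := shat n {s ∈ S | s n = some true}
  have hn : ∀ J ∈ A ∪ B, n ∉ J := by
    intro J hJ hnJ
    rcases Finset.mem_union.1 hJ with h | h
    · have := (mem_shat.1 h).1 hnJ; simp at this
    · have := (mem_shat.1 h).1 hnJ; simp at this
  rw [← Finset.card_union_add_card_inter]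
  have hinj : ((A ∩ B).image (insert n)).card = (A ∩ B).card := by
    refine Finset.card_image_of_injOn ?_
    intro J hJ J' hJ' h
    have h1 := hn J (Finset.inter_subset_union (Finset.mem_coe.1 hJ))
    have h2 := hn J' (Finset.inter_subset_union (Finset.mem_coe.1 hJ'))
    rw [← Finset.erase_insert h1, ← Finset.erase_insert h2, h]
  rw [← hinj, ← Finset.card_union_of_disjoint]
  · refine Finset.card_le_card (Finset.union_subset (Finset.union_subset ?_ ?_) ?_)
    · exact shat_mono (Nat.le_succ n) (fun s hs => hs.1)
    · exact shat_mono (Nat.le_succ n) (fun s hs => hs.1)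
    · intro K hK
      obtain ⟨J, hJ, rfl⟩ := Finset.mem_image.1 hK
      have hA := mem_shat.1 (Finset.mem_inter.1 hJ).1
      have hB := mem_shat.1 (Finset.mem_inter.1 hJ).2
      rw [mem_shat]
      refine ⟨?_, fun σ => ?_⟩
      · intro x hx
        rcases Finset.mem_insert.1 hx with h | h
        · simp [h]
        · have := Finset.mem_range.1 (hA.1 h); exact Finset.mem_range.2 (by omega)
      · cases hσ : σ n
        · obtain ⟨s, hs, h'⟩ := hA.2 σ
          refine ⟨s, hs.1, fun i hi => ?_⟩
          rcases Finset.mem_insert.1 hi with h | h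
          · rw [h, hσ]; exact hs.2
          · exact h' i h
        · obtain ⟨s, hs, h'⟩ := hB.2 σ
          refine ⟨s, hs.1, fun i hi => ?_⟩
          rcases Finset.mem_insert.1 hi with h | h
          · rw [h, hσ]; exact hs.2
          · exact h' i h
  · rw [Finset.disjoint_left]
    intro J hJ hJ'
    obtain ⟨J', _, rfl⟩ := Finset.mem_image.1 hJ'
    exact hn _ hJ (Finset.mem_insert_self _ _)

lemma pascal_sum (n L : ℕ) : (∑ i ∈ Finset.range (L + 2), (n + 1).choose i) =
    (∑ i ∈ Finset.range (L + 2), n.choose i) + ∑ i ∈ Finset.range (L + 1), n.choose i := by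
  rw [Finset.sum_range_succ' (fun i => (n + 1).choose i), Finset.sum_range_succ' (fun i => n.choose i)]
  simp only [Nat.choose_succ_succ', Finset.sum_add_distrib, Nat.choose_zero_right]
  omega

/-- Few shattered sets imply a small cover. -/
lemma few_shattered (n : ℕ) : ∀ (L : ℕ) (S : Set (ℕ → Option Bool)),
    (shat n S).card < 2 ^ (L + 1) →
    ∃ G : Finset (ℕ → Bool), G.card ≤ ∑ i ∈ Finset.range (L + 1), n.choose i ∧
      ∀ s ∈ S, ∃ g ∈ G, ∀ i < n, s i ≠ some (!g i) := by
  induction n with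
  | zero =>
    intro L S _
    refine ⟨{fun _ => true}, ?_, fun s _ => ⟨_, Finset.mem_singleton_self _, by omega⟩⟩
    rw [Finset.sum_range_succ']
    simp
  | succ n ih =>
    intro L S hS
    have hb : ∃ b : Bool, (shat n {s ∈ S | s n = some b}).card < 2 ^ L := by
      by_contra! hc
      have h1 := hc false
      have h2 := hc true
      have := shat_add n S
      rw [pow_succ] at hS
      omega
    obtain ⟨b, hb⟩ := hb
    have hS' : (shat n {s ∈ S | s n ≠ some b}).card < 2 ^ (L + 1) :=
      lt_of_le_of_lt (Finset.card_le_card (shat_mono (Nat.le_succ n) (fun s hs => hs.1))) hS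
    obtain ⟨G1, hG1, hG1'⟩ := ih L _ hS'
    have key1 : ∀ s ∈ {s ∈ S | s n ≠ some b},
        ∃ g ∈ G1.image (fun g => Function.update g n (!b)), ∀ i < n + 1, s i ≠ some (!g i) := by
      intro s hs
      obtain ⟨g, hg, h⟩ := hG1' s hs
      refine ⟨_, Finset.mem_image_of_mem _ hg, fun i hi => ?_⟩
      rcases Nat.lt_succ_iff_lt_or_eq.1 hi with h' | h'
      · rw [Function.update_of_ne (by omega)]; exact h i h'
      · rw [h', Function.update_self, Bool.not_not]; exact hs.2
    rcases L with _ | L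
    · refine ⟨G1.image (fun g => Function.update g n (!b)), ?_, ?_⟩
      · refine Finset.card_image_le.trans (hG1.trans ?_); simp
      · intro s hs
        refine key1 s ⟨hs, fun hsb => ?_⟩
        have : ∅ ∈ shat n {s ∈ S | s n = some b} := by
          rw [mem_shat]; exact ⟨by simp, fun σ => ⟨s, ⟨hs, hsb⟩, by simp⟩⟩
        have := Finset.card_pos.2 ⟨_, this⟩
        rw [pow_zero] at hb
        omega
    · obtain ⟨G2, hG2, hG2'⟩ := ih L _ hb
      refine ⟨G1.image (fun g => Function.update g n (!b)) ∪
        G2.image (fun g => Function.update g n b), ?_, ?_⟩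
      · rw [pascal_sum]
        refine (Finset.card_union_le _ _).trans (add_le_add ?_ ?_)
        · exact Finset.card_image_le.trans hG1
        · exact Finset.card_image_le.trans hG2
      · intro s hs
        by_cases hsb : s n = some b
        · obtain ⟨g, hg, h⟩ := hG2' s ⟨hs, hsb⟩
          refine ⟨_, Finset.mem_union_right _ (Finset.mem_image_of_mem _ hg), fun i hi => ?_⟩
          rcases Nat.lt_succ_iff_lt_or_eq.1 hi with h' | h'
          · rw [Function.update_of_ne (by omega)]; exact h i h'
          · rw [h', Function.update_self, hsb]; cases b <;> simp
        · obtain ⟨g, hg, h⟩ := key1 s ⟨hs, hsb⟩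
          exact ⟨g, Finset.mem_union_left _ hg, h⟩

lemma choose_sum_le {γ : ℝ} (hγ : 0 < γ) : ∃ c : ℝ, 0 < c ∧ ∀ n d : ℕ, (d : ℝ) ≤ c * n →
    ((∑ i ∈ Finset.range (d + 1), n.choose i : ℕ) : ℝ) ≤ Real.exp (γ * n) := by
  set x : ℝ := min (γ / 2) 1 with hx
  have hx0 : 0 < x := lt_min (by positivity) one_pos
  have hx1 : x ≤ 1 := min_le_right _ _
  have hx2 : x ≤ γ / 2 := min_le_left _ _
  have hl : 0 ≤ -Real.log x := by have := Real.log_nonpos hx0.le hx1; linarith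
  refine ⟨γ / 2 / (-Real.log x + 1), by positivity, fun n d hd => ?_⟩
  have h1 : x ^ d * ((∑ i ∈ Finset.range (d + 1), n.choose i : ℕ) : ℝ) ≤ (x + 1) ^ n := by
    push_cast
    rw [Finset.mul_sum, add_pow]
    calc ∑ i ∈ Finset.range (d + 1), x ^ d * (n.choose i : ℝ)
        ≤ ∑ i ∈ Finset.range (d + 1), x ^ i * 1 ^ (n - i) * (n.choose i : ℝ) := by
          refine Finset.sum_le_sum fun i hi => ?_
          rw [one_pow, mul_one]
          refine mul_le_mul_of_nonneg_right ?_ (Nat.cast_nonneg _)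
          exact pow_le_pow_of_le_one hx0.le hx1 (by have := Finset.mem_range.1 hi; omega)
      _ ≤ ∑ i ∈ Finset.range (d + 1 + (n + 1)), x ^ i * 1 ^ (n - i) * (n.choose i : ℝ) := by
          refine Finset.sum_le_sum_of_subset_of_nonneg (Finset.range_mono (by omega)) ?_
          intro i _ _; positivity
      _ = ∑ i ∈ Finset.range (n + 1), x ^ i * 1 ^ (n - i) * (n.choose i : ℝ) := by
          symm
          refine Finset.sum_subset (Finset.range_mono (by omega)) ?_
          intro i _ hi
          rw [Nat.choose_eq_zero_of_lt (by simpa using hi)]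
          simp
  have h2 : (x + 1) ^ n ≤ Real.exp (x * n) := by
    rw [mul_comm, Real.exp_nat_mul]
    exact pow_le_pow_left₀ (by positivity) (Real.add_one_le_exp x) n
  have h3 : x ^ d = Real.exp (d * Real.log x) := by
    rw [Real.exp_nat_mul, Real.exp_log hx0]
  rw [h3] at h1
  have h4 := h1.trans h2
  have h5 : ((∑ i ∈ Finset.range (d + 1), n.choose i : ℕ) : ℝ) ≤
      Real.exp (x * n + d * (-Real.log x)) := by
    have e : Real.exp (x * n + d * (-Real.log x)) =
        Real.exp (x * n) / Real.exp (d * Real.log x) := by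
      rw [← Real.exp_sub]; congr 1; ring
    rw [e, le_div_iff₀ (Real.exp_pos _), mul_comm]
    exact h4
  refine h5.trans (Real.exp_le_exp.2 ?_)
  have h6 : (d : ℝ) * (-Real.log x + 1) ≤ γ / 2 * n := by
    have := mul_le_mul_of_nonneg_right hd (show 0 ≤ -Real.log x + 1 by linarith)
    rwa [show γ / 2 / (-Real.log x + 1) * n * (-Real.log x + 1) = γ / 2 * n by field_simp] at this
  have h7 : x * n ≤ γ / 2 * n := mul_le_mul_of_nonneg_right hx2 (Nat.cast_nonneg _)
  have h8 : (0 : ℝ) ≤ d := Nat.cast_nonneg _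
  nlinarith

section
variable {X : Type*} [TopologicalSpace X]

/-- `I` is an independence set of times for `(U, V)`. -/
def Indp (T : X ≃ₜ X) (U V : Set X) (I : Finset ℤ) : Prop :=
  ∀ σ : ℤ → Bool, ∃ x : X, ∀ t ∈ I, (T ^ t) x ∈ (if σ t then U else V)

lemma hpow_add (T : X ≃ₜ X) (s t : ℤ) (x : X) : (T ^ (s + t)) x = (T ^ s) ((T ^ t) x) := by
  rw [zpow_add]; rfl

lemma hpow_nat (T : X ≃ₜ X) (n : ℕ) (x : X) : (T ^ (n : ℤ)) x = T^[n] x := by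
  induction n generalizing x with
  | zero => simp
  | succ n ih =>
    rw [Nat.cast_succ, hpow_add, zpow_one, ih, Function.iterate_succ_apply]

lemma hpow_neg (T : X ≃ₜ X) (n : ℕ) (x : X) : (T ^ (-(n : ℤ))) x = T.symm^[n] x := by
  have h : (T ^ (-(n : ℤ))) = (T.symm) ^ (n : ℤ) := by
    rw [zpow_neg, ← inv_zpow]; rfl
  rw [h, hpow_nat]

lemma Indp.mono {T : X ≃ₜ X} {U V : Set X} {I J : Finset ℤ} (h : Indp T U V I) (hJ : J ⊆ I) :
    Indp T U V J := fun σ => by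
  obtain ⟨x, hx⟩ := h σ
  exact ⟨x, fun t ht => hx t (hJ ht)⟩

lemma Indp.shift {T : X ≃ₜ X} {U V : Set X} {I : Finset ℤ} (h : Indp T U V I) (a : ℤ) :
    Indp T U V (I.image (· + a)) := fun σ => by
  obtain ⟨x, hx⟩ := h (fun t => σ (t + a))
  refine ⟨(T ^ (-a)) x, fun t ht => ?_⟩
  obtain ⟨u, hu, rfl⟩ := Finset.mem_image.1 ht
  rw [← hpow_add, add_neg_cancel_right]
  exact hx u hu

/-- Maximal size of an independence set in `[0, N)`. -/
noncomputable def phi (T : X ≃ₜ X) (U V : Set X) (N : ℕ) : ℕ :=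
  ((Finset.Ico (0 : ℤ) N).powerset.filter (fun I => Indp T U V I)).sup Finset.card

lemma exists_phi [Nonempty X] (T : X ≃ₜ X) (U V : Set X) (N : ℕ) :
    ∃ I : Finset ℤ, I ⊆ Finset.Ico (0 : ℤ) N ∧ Indp T U V I ∧ I.card = phi T U V N := by
  have hne : ((Finset.Ico (0 : ℤ) N).powerset.filter (fun I => Indp T U V I)).Nonempty := by
    refine ⟨∅, ?_⟩
    rw [Finset.mem_filter, Finset.mem_powerset]
    exact ⟨by simp, fun σ => ⟨Classical.arbitrary X, by simp⟩⟩
  obtain ⟨I, hI, h⟩ := Finset.exists_mem_eq_sup _ hne Finset.card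
  rw [Finset.mem_filter, Finset.mem_powerset] at hI
  exact ⟨I, hI.1, hI.2, h.symm⟩

lemma card_le_phi {T : X ≃ₜ X} {U V : Set X} {I : Finset ℤ} (h : Indp T U V I) (a : ℤ) (L : ℕ)
    (hI : I ⊆ Finset.Ico a (a + L)) : I.card ≤ phi T U V L := by
  have e : (I.image (· + -a)).card = I.card :=
    Finset.card_image_of_injective _ (add_left_injective _)
  rw [← e]
  refine Finset.le_sup (f := Finset.card) ?_
  rw [Finset.mem_filter, Finset.mem_powerset]
  refine ⟨?_, h.shift _⟩
  intro t ht
  obtain ⟨u, hu, rfl⟩ := Finset.mem_image.1 ht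
  have := Finset.mem_Ico.1 (hI hu)
  simp only [Finset.mem_Ico]; omega

/-- Partial itinerary. -/
noncomputable def itin (T : X ≃ₜ X) (U V : Set X) (x : X) (i : ℕ) : Option Bool :=
  if T^[i] x ∈ U then some true else if T^[i] x ∈ V then some false else none

lemma coverNum_le (T : X ≃ₜ X) {U V : Set X} (hUV : Disjoint U V) (n : ℕ)
    (G : Finset (ℕ → Bool))
    (hG : ∀ s ∈ Set.range (itin T U V), ∃ g ∈ G, ∀ i < n, s i ≠ some (!g i)) :
    coverNum T ![Uᶜ, Vᶜ] n ≤ G.card := by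
  refine Nat.sInf_le ⟨fun j i => if ((G.equivFin.symm j : ℕ → Bool) i) then 1 else 0, ?_⟩
  rw [Set.eq_univ_iff_forall]
  intro x
  obtain ⟨g, hg, h⟩ := hG _ ⟨x, rfl⟩
  rw [Set.mem_iUnion]
  refine ⟨G.equivFin ⟨g, hg⟩, ?_⟩
  rw [Set.mem_iInter]
  intro i
  have := h i i.2
  simp only [Equiv.symm_apply_apply, Set.mem_preimage]
  unfold itin at this
  cases hgi : g i
  · simp only [hgi] at this ⊢
    simp only [Bool.false_eq_true, if_false, Matrix.cons_val_zero, Set.mem_compl_iff]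
    intro hU; simp [hU] at this
  · simp only [hgi] at this ⊢
    simp only [if_true, Matrix.cons_val_one, Matrix.cons_val_fin_one, Set.mem_compl_iff]
    intro hV
    have hU : T^[i] x ∉ U := fun hU => Set.disjoint_left.1 hUV hU hV
    simp [hU, hV] at this

lemma shat_indp (T : X ≃ₜ X) {U V : Set X} {n : ℕ} {J : Finset ℕ}
    (hJ : J ∈ shat n (Set.range (itin T U V))) : Indp T U V (J.image (fun i : ℕ => (i : ℤ))) := by
  intro σ
  obtain ⟨s, ⟨x, rfl⟩, h⟩ := (mem_shat.1 hJ).2 (fun i => σ i)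
  refine ⟨x, fun t ht => ?_⟩
  obtain ⟨i, hi, rfl⟩ := Finset.mem_image.1 ht
  have := h i hi
  rw [hpow_nat]
  unfold itin at this
  by_cases h1 : T^[i] x ∈ U
  · simp only [h1, if_true, Option.some.injEq] at this
    rw [← this]; simpa using h1
  · by_cases h2 : T^[i] x ∈ V
    · simp only [h1, h2, if_true, if_false, Option.some.injEq] at this
      rw [← this]; simpa using h2
    · simp [h1, h2] at this

lemma phi_ge (T : X ≃ₜ X) {U V : Set X} (hUV : Disjoint U V)
    (h : 0 < coverEntropyOf T ![Uᶜ, Vᶜ]) :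
    ∃ c : ℝ, 0 < c ∧ ∀ n : ℕ, 1 ≤ n → c * n ≤ phi T U V n := by
  set η := coverEntropyOf T ![Uᶜ, Vᶜ] with hη
  obtain ⟨c1, hc1, H1⟩ := choose_sum_le (half_pos h)
  have hl2 : 0 < Real.log 2 := Real.log_pos (by norm_num)
  obtain ⟨c2, hc2, H2⟩ := choose_sum_le (show 0 < c1 * Real.log 2 / 2 by positivity)
  refine ⟨c2, hc2, fun n hn => ?_⟩
  by_contra! hlt
  have hnR : (0 : ℝ) < n := by exact_mod_cast hn
  have h1 : η * n ≤ Real.log (coverNum T ![Uᶜ, Vᶜ] n) := by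
    obtain ⟨m, rfl⟩ : ∃ m, n = m + 1 := ⟨n - 1, by omega⟩
    have : η ≤ Real.log (coverNum T ![Uᶜ, Vᶜ] (m + 1)) / (m + 1) := by
      refine ciInf_le (f := fun m : ℕ => Real.log (coverNum T ![Uᶜ, Vᶜ] (m + 1)) / (m + 1))
        ⟨0, ?_⟩ m
      rintro _ ⟨k, rfl⟩
      exact div_nonneg (Real.log_natCast_nonneg _) (by positivity)
    rw [le_div_iff₀ (by positivity)] at this
    push_cast; exact this
  have hpos : (0 : ℝ) < coverNum T ![Uᶜ, Vᶜ] n := by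
    rcases Nat.eq_zero_or_pos (coverNum T ![Uᶜ, Vᶜ] n) with h0 | h0
    · rw [h0] at h1; simp at h1
      have := mul_pos h hnR; linarith
    · exact_mod_cast h0
  rw [Real.le_log_iff_exp_le hpos] at h1
  have h2 : ((shat n (Set.range (itin T U V))).card : ℝ) ≤
      Real.exp (c1 * Real.log 2 / 2 * n) := by
    refine le_trans ?_ (H2 n (phi T U V n) hlt.le)
    have : shat n (Set.range (itin T U V)) ⊆
        (Finset.range (phi T U V n + 1)).biUnion (fun i => (Finset.range n).powersetCard i) := by
      intro J hJ
      rw [Finset.mem_biUnion]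
      refine ⟨J.card, ?_, Finset.mem_powersetCard.2 ⟨(mem_shat.1 hJ).1, rfl⟩⟩
      have h3 := card_le_phi (shat_indp T hJ) 0 n (by
        intro t ht
        obtain ⟨i, hi, rfl⟩ := Finset.mem_image.1 ht
        have := Finset.mem_range.1 ((mem_shat.1 hJ).1 hi)
        rw [Finset.mem_Ico]; omega)
      rw [Finset.card_image_of_injective _ Nat.cast_injective] at h3
      exact Finset.mem_range.2 (by omega)
    have h3 := (Finset.card_le_card this).trans Finset.card_biUnion_le
    simp only [Finset.card_powersetCard, Finset.card_range] at h3
    exact_mod_cast h3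
  set L := ⌊c1 * n⌋₊ with hL
  have hL1 : (L : ℝ) ≤ c1 * n := Nat.floor_le (by positivity)
  have hL2 : c1 * n < L + 1 := Nat.lt_floor_add_one _
  have h4 : (shat n (Set.range (itin T U V))).card < 2 ^ (L + 1) := by
    have : ((shat n (Set.range (itin T U V))).card : ℝ) < (2 : ℝ) ^ (L + 1) := by
      refine lt_of_le_of_lt h2 ?_
      have e : (2 : ℝ) ^ (L + 1) = Real.exp ((L + 1 : ℕ) * Real.log 2) := by
        rw [Real.exp_nat_mul, Real.exp_log (by norm_num)]
      rw [e, Real.exp_lt_exp]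
      push_cast
      have := mul_lt_mul_of_pos_right hL2 hl2
      have : 0 < c1 * n * Real.log 2 := by positivity
      nlinarith
    exact_mod_cast this
  obtain ⟨G, hG, hG'⟩ := few_shattered n L _ h4
  have h5 := coverNum_le T hUV n G hG'
  have h6 : (coverNum T ![Uᶜ, Vᶜ] n : ℝ) ≤ Real.exp (η / 2 * n) :=
    le_trans (by exact_mod_cast h5.trans hG) (H1 n L hL1)
  have h7 := Real.exp_le_exp.1 (h1.trans h6)
  have := mul_pos h hnR
  linarith

/-- The optimal density and the existence of almost optimal lengths. -/
lemma phi_opt (T : X ≃ₜ X) {U V : Set X} (hUV : Disjoint U V)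
    (h : 0 < coverEntropyOf T ![Uᶜ, Vᶜ]) :
    ∃ c : ℝ, 0 < c ∧ (∀ n : ℕ, 1 ≤ n → c * n ≤ phi T U V n) ∧
      ∀ δ : ℝ, 0 < δ → δ < 1 → ∃ L : ℕ, 1 ≤ L ∧ phi T U V L * (1 - δ) ≤ c * L := by
  obtain ⟨c', hc', H⟩ := phi_ge T hUV h
  have hpos : ∀ n : ℕ, (0 : ℝ) < (n : ℝ) + 1 := fun n => by positivity
  have hb : BddBelow (Set.range fun n : ℕ => (phi T U V (n + 1) : ℝ) / (n + 1)) :=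
    ⟨0, by rintro _ ⟨n, rfl⟩; positivity⟩
  have hc : c' ≤ ⨅ n : ℕ, (phi T U V (n + 1) : ℝ) / (n + 1) := by
    refine le_ciInf fun n => ?_
    rw [le_div_iff₀ (hpos n)]
    have := H (n + 1) (by omega)
    push_cast at this; exact this
  set c := ⨅ n : ℕ, (phi T U V (n + 1) : ℝ) / (n + 1) with hcdef
  have hcpos : 0 < c := lt_of_lt_of_le hc' hc
  refine ⟨c, hcpos, fun n hn => ?_, fun δ hδ hδ1 => ?_⟩
  · obtain ⟨m, rfl⟩ : ∃ m, n = m + 1 := ⟨n - 1, by omega⟩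
    have := ciInf_le hb m
    rw [← hcdef, le_div_iff₀ (hpos m)] at this
    push_cast; exact this
  · have h1 : c < c / (1 - δ) := by
      rw [lt_div_iff₀ (by linarith)]; nlinarith
    obtain ⟨n, hn⟩ := exists_lt_of_ciInf_lt h1
    refine ⟨n + 1, by omega, ?_⟩
    rw [div_lt_div_iff₀ (hpos n) (by linarith)] at hn
    push_cast; exact hn.le

end
end AsymLY

namespace AsymLY

/-- A sequence of finite entropy functions with independent positions in row `0`. -/
structure HSys (c : ℝ) (φ : ℕ → ℕ) (I : ℕ → Finset ℤ) (C : Finset (ℕ × ℤ) → ℝ)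
    (H : ℕ → Finset (ℕ × ℤ) → ℝ) : Prop where
  empty : ∀ N, H N ∅ = 0
  mono : ∀ N {A B}, A ⊆ B → H N A ≤ H N B
  submod : ∀ N {A B D}, D ⊆ A → D ⊆ B → H N (A ∪ B) + H N D ≤ H N A + H N B
  bound : ∀ N A, H N A ≤ C A
  Cshift : ∀ n A, C (sh n A) = C A
  hrow : ∀ N W, H N (row W) = ((W ∩ I N).card : ℝ) * Real.log 2
  sub : ∀ N, I N ⊆ Finset.Ico (0 : ℤ) N
  dens : ∀ N, 1 ≤ N → c * N ≤ (I N).card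
  loc : ∀ N (a : ℤ) (L : ℕ), (Finset.Ico a (a + L) ∩ I N).card ≤ φ L

/-- Averaged entropy. -/
noncomputable def av (H : ℕ → Finset (ℕ × ℤ) → ℝ) (N : ℕ) (A : Finset (ℕ × ℤ)) : ℝ :=
  (∑ s ∈ Finset.range N, H N (sh s A)) / N

section
variable {c : ℝ} {φ : ℕ → ℕ} {I : ℕ → Finset ℤ} {C : Finset (ℕ × ℤ) → ℝ}
  {H : ℕ → Finset (ℕ × ℤ) → ℝ}

lemma HSys.nonneg (S : HSys c φ I C H) (N A) : 0 ≤ H N A := by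
  rw [← S.empty N]; exact S.mono N (Finset.empty_subset _)

lemma HSys.av_mem (S : HSys c φ I C H) (N A) : av H N A ∈ Set.Icc 0 (C A) := by
  have hC : 0 ≤ C A := (S.nonneg 0 A).trans (S.bound 0 A)
  constructor
  · exact div_nonneg (Finset.sum_nonneg fun s _ => S.nonneg _ _) (Nat.cast_nonneg _)
  · refine div_le_of_le_mul₀ (Nat.cast_nonneg _) hC ?_
    refine (Finset.sum_le_sum (g := fun _ => C A) fun s _ => ?_).trans ?_
    · rw [← S.Cshift s A]; exact S.bound _ _
    · simp [mul_comm]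

lemma HSys.exists_lim (S : HSys c φ I C H) (A) :
    ∃ y, Tendsto (fun N => av H N A) (hyperfilter ℕ : Filter ℕ) (𝓝 y) := by
  have := (isCompact_Icc (a := (0 : ℝ)) (b := C A)).ultrafilter_le_nhds
    ((hyperfilter ℕ).map (fun N => av H N A)) (by
      rw [Filter.le_principal_iff]
      exact Filter.mem_map.2 (Filter.univ_mem' fun N => S.av_mem N A))
  obtain ⟨y, -, hy⟩ := this
  exact ⟨y, hy⟩

lemma hyper_atTop : (hyperfilter ℕ : Filter ℕ) ≤ atTop := Nat.hyperfilter_le_atTop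

lemma sh_row (n : ℤ) (W : Finset ℤ) : sh n (row W) = row (W.image (· + n)) := by
  ext x
  simp only [mem_sh, mem_row, Finset.mem_image]
  constructor
  · rintro ⟨h1, h2⟩; exact ⟨h1, x.2 - n, h2, by ring⟩
  · rintro ⟨h1, t, ht, h2⟩; exact ⟨h1, by rw [← h2]; simpa using ht⟩

lemma HSys.av_single (S : HSys c φ I C H) (N : ℕ) :
    ∑ s ∈ Finset.range N, H N (sh s (row {0})) = ((I N).card : ℝ) * Real.log 2 := by
  have h1 : ∀ s ∈ Finset.range N, H N (sh s (row {0})) =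
      (if (s : ℤ) ∈ I N then (1 : ℝ) else 0) * Real.log 2 := by
    intro s _
    rw [sh_row, S.hrow]
    simp only [Finset.image_singleton, zero_add, Finset.singleton_inter]
    split_ifs <;> simp
  rw [Finset.sum_congr rfl h1, ← Finset.sum_mul, Finset.sum_boole]
  congr 2
  refine Finset.card_bij (fun s _ => (s : ℤ)) ?_ ?_ ?_
  · intro s hs; exact (Finset.mem_filter.1 hs).2
  · intro a _ b _ h; exact_mod_cast h
  · intro t ht
    have := Finset.mem_Ico.1 (S.sub N ht)
    refine ⟨t.toNat, ?_, by omega⟩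
    rw [Finset.mem_filter, Finset.mem_range]
    refine ⟨by omega, ?_⟩
    rwa [Int.toNat_of_nonneg this.1]

lemma HSys.row_sum (S : HSys c φ I C H) (N : ℕ) (W : Finset ℤ) :
    H N (row W) = ∑ w ∈ W, H N (row {w}) := by
  simp only [S.hrow, ← Finset.sum_mul]
  congr 1
  rw [← Finset.filter_mem_eq_inter, Finset.card_filter]
  push_cast
  refine Finset.sum_congr rfl fun w _ => ?_
  rw [Finset.singleton_inter]
  split_ifs <;> simp

lemma HSys.lim (S : HSys c φ I C H) : ∃ (f : Finset (ℕ × ℤ) → ℝ) (h0 : ℝ), Poly f h0 ∧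
    c * Real.log 2 ≤ h0 ∧
    ∀ A, Tendsto (fun N => av H N A) (hyperfilter ℕ : Filter ℕ) (𝓝 (f A)) := by
  choose f hf using S.exists_lim
  have hshift1 : ∀ A, f (sh 1 A) = f A := by
    intro A
    have h1 := (hf (sh 1 A)).sub (hf A)
    have h2 : Tendsto (fun N => av H N (sh 1 A) - av H N A) (hyperfilter ℕ : Filter ℕ) (𝓝 0) := by
      have hz : Tendsto (fun N : ℕ => C A / (N : ℝ)) atTop (𝓝 0) :=
        tendsto_const_div_atTop_nhds_zero_nat _
      refine squeeze_zero_norm (fun N => ?_) (hz.mono_left hyper_atTop)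
      have e : av H N (sh 1 A) - av H N A = (H N (sh N A) - H N A) / N := by
        unfold av
        rw [← sub_div, ← Finset.sum_sub_distrib]
        have := Finset.sum_range_sub (fun s : ℕ => H N (sh s A)) N
        simp only [Nat.cast_zero, sh_zero] at this
        rw [← this]
        congr 1
        refine Finset.sum_congr rfl fun s _ => ?_
        rw [sh_sh]; push_cast; rfl
      rw [e, Real.norm_eq_abs, abs_div, Nat.abs_cast]
      refine div_le_div_of_nonneg_right ?_ (Nat.cast_nonneg _)
      have a1 := S.nonneg N A
      have a2 := S.nonneg N (sh N A)
      have a3 := S.bound N A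
      have a4 := S.bound N (sh N A)
      rw [S.Cshift] at a4
      rw [abs_le]; constructor <;> linarith
    have := tendsto_nhds_unique h1 h2
    linarith
  have hshift : ∀ n A, f (sh n A) = f A := by
    intro n A
    induction n using Int.induction_on with
    | zero => rw [sh_zero]
    | succ i ih => rw [← ih, add_comm, ← sh_sh, hshift1]
    | pred i ih =>
      rw [← ih, ← hshift1 (sh (-i - 1) A), sh_sh]; congr 2; ring
  refine ⟨f, f (row {0}), ⟨?_, ?_, ?_, hshift, ?_⟩, ?_, hf⟩
  · have : (fun N => av H N ∅) = fun _ => (0 : ℝ) := by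
      funext N
      have e : ∀ s : ℤ, sh s ∅ = ∅ := fun s => rfl
      simp [av, e, S.empty]
    have h1 := hf ∅
    rw [this] at h1
    exact tendsto_nhds_unique h1 tendsto_const_nhds
  · intro A B h
    refine le_of_tendsto_of_tendsto' (hf A) (hf B) fun N => ?_
    refine div_le_div_of_nonneg_right (Finset.sum_le_sum fun s _ => S.mono N ?_) (Nat.cast_nonneg _)
    intro x hx; rw [mem_sh] at *; exact h hx
  · intro A B D hA hB
    refine le_of_tendsto_of_tendsto' ((hf (A ∪ B)).add (hf D)) ((hf A).add (hf B)) fun N => ?_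
    unfold av
    rw [← add_div, ← add_div, ← Finset.sum_add_distrib, ← Finset.sum_add_distrib]
    refine div_le_div_of_nonneg_right (Finset.sum_le_sum fun s _ => ?_) (Nat.cast_nonneg _)
    rw [sh_union]
    refine S.submod N ?_ ?_
    · intro x hx; rw [mem_sh] at *; exact hA hx
    · intro x hx; rw [mem_sh] at *; exact hB hx
  · intro W
    have h1 : Tendsto (fun N => av H N (row W)) (hyperfilter ℕ : Filter ℕ)
        (𝓝 (∑ w ∈ W, f (row {w}))) := by
      have := tendsto_finsetSum W (fun w _ => hf (row {w}))
      refine this.congr fun N => ?_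
      unfold av
      rw [← Finset.sum_div, Finset.sum_comm]
      congr 1
      refine Finset.sum_congr rfl fun s _ => ?_
      rw [sh_row, S.row_sum, Finset.sum_image (fun a _ b _ h => by simpa using h)]
      refine Finset.sum_congr rfl fun w _ => ?_
      rw [sh_row, Finset.image_singleton]
    rw [tendsto_nhds_unique (hf (row W)) h1]
    have : ∀ w ∈ W, f (row {w}) = f (row {0}) := by
      intro w _
      rw [← hshift w (row {0}), sh_row, Finset.image_singleton, zero_add]
    rw [Finset.sum_congr rfl this]
    simp
  · refine ge_of_tendsto (hf (row {0})) ?_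
    filter_upwards [hyper_atTop (eventually_ge_atTop 1)] with N hN
    unfold av
    rw [S.av_single, le_div_iff₀ (by exact_mod_cast hN)]
    have := S.dens N hN
    have hl2 : 0 < Real.log 2 := Real.log_pos (by norm_num)
    nlinarith

/-- The proportion of translates of a block missing `I N` is small. -/
lemma HSys.empties (S : HSys c φ I C H) {f : Finset (ℕ × ℤ) → ℝ} {h0 : ℝ} (P : Poly f h0)
    (hc : 0 < c) (hh : c * Real.log 2 ≤ h0)
    (hf : ∀ A, Tendsto (fun N => av H N A) (hyperfilter ℕ : Filter ℕ) (𝓝 (f A)))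
    (a : ℤ) (L : ℕ) (hL : 1 ≤ L) {δ : ℝ} (hδ : 0 < δ) (hLδ : φ L * (1 - δ) ≤ c * L)
    (hφ : c * L ≤ φ L) :
    ∀ᶠ N in (hyperfilter ℕ : Filter ℕ),
      (∑ s ∈ Finset.range N, if ((Finset.Ico a (a + L)).image (· + (s : ℤ)) ∩ I N) = ∅
        then (1 : ℝ) else 0) ≤ 2 * δ * N := by
  have hl2 : 0 < Real.log 2 := Real.log_pos (by norm_num)
  have hLR : (0 : ℝ) < L := by exact_mod_cast hL
  have hφ0 : (0 : ℝ) < φ L := lt_of_lt_of_le (mul_pos hc hLR) hφ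
  have hfB : f (row (Finset.Ico a (a + L))) = L * h0 := by
    rw [P.indep, Int.card_Ico]; congr 2; omega
  have h1 := hf (row (Finset.Ico a (a + L)))
  have h2 : f (row (Finset.Ico a (a + L))) - φ L * δ * Real.log 2 <
      f (row (Finset.Ico a (a + L))) := by
    have : 0 < φ L * δ * Real.log 2 := by positivity
    linarith
  filter_upwards [h1.eventually (lt_mem_nhds h2), hyper_atTop (eventually_ge_atTop 1)] with N hN hN1
  have hNR : (0 : ℝ) < N := by exact_mod_cast hN1
  rw [hfB] at hN
  unfold av at hN
  rw [lt_div_iff₀ hNR] at hN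
  have h3 : ∑ s ∈ Finset.range N, H N (sh s (row (Finset.Ico a (a + L)))) ≤
      ∑ s ∈ Finset.range N, (φ L * Real.log 2 * (1 -
        if ((Finset.Ico a (a + L)).image (· + (s : ℤ)) ∩ I N) = ∅ then (1 : ℝ) else 0)) := by
    refine Finset.sum_le_sum fun s _ => ?_
    rw [sh_row, S.hrow]
    split_ifs with h
    · rw [h]; simp
    · rw [sub_zero, mul_one]
      refine mul_le_mul_of_nonneg_right ?_ hl2.le
      have := S.loc N (a + s) L
      rw [Finset.image_add_right_Ico, show a + (L : ℤ) + s = a + s + L by ring]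
      exact_mod_cast this
  rw [← Finset.mul_sum, Finset.sum_sub_distrib] at h3
  simp only [Finset.sum_const, Finset.card_range, nsmul_eq_mul, mul_one] at h3
  set E := ∑ s ∈ Finset.range N, if ((Finset.Ico a (a + L)).image (· + (s : ℤ)) ∩ I N) = ∅
        then (1 : ℝ) else 0
  have h4 : (L * h0 - φ L * δ * Real.log 2) * N < φ L * Real.log 2 * (N - E) := lt_of_lt_of_le hN h3
  have h5 : L * (c * Real.log 2) ≤ L * h0 := mul_le_mul_of_nonneg_left hh hLR.le
  have h6 : φ L * (1 - δ) * Real.log 2 ≤ c * L * Real.log 2 := mul_le_mul_of_nonneg_right hLδ hl2.le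
  have h7 : (φ L * Real.log 2) * ((1 - 2 * δ) * N) ≤ (L * h0 - φ L * δ * Real.log 2) * N := by
    have : φ L * Real.log 2 * (1 - 2 * δ) ≤ L * h0 - φ L * δ * Real.log 2 := by linarith
    have := mul_le_mul_of_nonneg_right this hNR.le
    linarith
  have h8 := lt_of_mul_lt_mul_left (lt_of_le_of_lt h7 h4) (by positivity)
  linarith

/-- Selection of a good translate. -/
lemma HSys.good_shift (S : HSys c φ I C H) {f : Finset (ℕ × ℤ) → ℝ} {h0 : ℝ} (P : Poly f h0)
    (hc : 0 < c) (hh : c * Real.log 2 ≤ h0)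
    (hf : ∀ A, Tendsto (fun N => av H N A) (hyperfilter ℕ : Filter ℕ) (𝓝 (f A)))
    (L m : ℕ → ℕ) (hL : ∀ i, 1 ≤ L i)
    (hLδ : ∀ i, φ (L i) * (1 - (1 / 2 : ℝ) ^ (i + 3)) ≤ c * L i)
    (hφ : ∀ L : ℕ, 1 ≤ L → c * L ≤ φ L) (r : ℕ) (W : Finset ℤ) (G : Finset (ℕ × ℤ))
    (hG : f (row W) + f G - f (row W ∪ G) ≤ Real.log 2 / 8) :
    ∃ N s : ℕ, H N (sh s (row W)) + H N (sh s G) - H N (sh s (row W ∪ G)) < Real.log 2 ∧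
      ∀ i < r, ∃ d ∈ Finset.Ico (-(m i : ℤ)) (-(m i : ℤ) + L i), d + s ∈ I N := by
  have hl2 : 0 < Real.log 2 := Real.log_pos (by norm_num)
  have h1 : Tendsto (fun N => av H N (row W) + av H N G - av H N (row W ∪ G))
      (hyperfilter ℕ : Filter ℕ) (𝓝 (f (row W) + f G - f (row W ∪ G))) :=
    ((hf _).add (hf _)).sub (hf _)
  have h2 := h1.eventually (gt_mem_nhds (show f (row W) + f G - f (row W ∪ G) < Real.log 2 / 4 by
    linarith))
  have h3 : ∀ᶠ N in (hyperfilter ℕ : Filter ℕ), ∀ i ∈ Finset.range r,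
      (∑ s ∈ Finset.range N, if ((Finset.Ico (-(m i : ℤ)) (-(m i : ℤ) + L i)).image (· + (s : ℤ))
        ∩ I N) = ∅ then (1 : ℝ) else 0) ≤ 2 * (1 / 2 : ℝ) ^ (i + 3) * N :=
    (Filter.eventually_all_finset _).2 fun i _ => S.empties P hc hh hf _ (L i) (hL i)
      (by positivity) (hLδ i) (hφ _ (hL i))
  obtain ⟨N, hN2, hN3, hN1⟩ :=
    (h2.and (h3.and (hyper_atTop (eventually_ge_atTop 1)))).exists
  have hNR : (0 : ℝ) < N := by exact_mod_cast hN1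
  refine ⟨N, ?_⟩
  by_contra! hcon
  have key : ∀ s ∈ Finset.range N, (1 : ℝ) ≤
      (H N (sh s (row W)) + H N (sh s G) - H N (sh s (row W ∪ G))) / Real.log 2 +
      ∑ i ∈ Finset.range r, (if ((Finset.Ico (-(m i : ℤ)) (-(m i : ℤ) + L i)).image (· + (s : ℤ))
        ∩ I N) = ∅ then (1 : ℝ) else 0) := by
    intro s _
    have hsum : ∀ i ∈ Finset.range r, (0 : ℝ) ≤
      (if ((Finset.Ico (-(m i : ℤ)) (-(m i : ℤ) + L i)).image (· + (s : ℤ))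
        ∩ I N) = ∅ then (1 : ℝ) else 0) := by intro i _; split_ifs <;> norm_num
    have hg0 : 0 ≤ H N (sh s (row W)) + H N (sh s G) - H N (sh s (row W ∪ G)) := by
      have := S.submod N (A := sh s (row W)) (B := sh s G) (D := ∅) (by simp) (by simp)
      rw [S.empty, ← sh_union] at this
      linarith
    by_cases hg : H N (sh s (row W)) + H N (sh s G) - H N (sh s (row W ∪ G)) < Real.log 2
    · obtain ⟨i, hi, hd⟩ := hcon s hg
      have he : ((Finset.Ico (-(m i : ℤ)) (-(m i : ℤ) + L i)).image (· + (s : ℤ)) ∩ I N) = ∅ := by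
        rw [Finset.eq_empty_iff_forall_notMem]
        intro t ht
        rw [Finset.mem_inter, Finset.mem_image] at ht
        obtain ⟨⟨d, hd1, rfl⟩, hd2⟩ := ht
        exact hd d hd1 hd2
      have := Finset.single_le_sum hsum (Finset.mem_range.2 hi)
      rw [if_pos he] at this
      have h4 := div_nonneg hg0 hl2.le
      linarith
    · have h4 : 1 ≤ (H N (sh s (row W)) + H N (sh s G) - H N (sh s (row W ∪ G))) / Real.log 2 := by
        rw [le_div_iff₀ hl2]; linarith [not_lt.1 hg]
      have := Finset.sum_nonneg hsum
      linarith
  have h5 := Finset.sum_le_sum key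
  rw [Finset.sum_add_distrib, Finset.sum_comm, ← Finset.sum_div] at h5
  simp only [Finset.sum_const, Finset.card_range, nsmul_eq_mul, mul_one, Finset.sum_add_distrib,
    Finset.sum_sub_distrib] at h5
  have h6 := Finset.sum_le_sum hN3
  rw [← Finset.sum_mul, ← Finset.mul_sum] at h6
  have h7 : ∑ i ∈ Finset.range r, (1 / 2 : ℝ) ^ (i + 3) ≤ 1 / 4 := by
    have : ∀ r : ℕ, ∑ i ∈ Finset.range r, (1 / 2 : ℝ) ^ (i + 3) = 1 / 4 - (1 / 2) ^ (r + 2) := by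
      intro r
      induction r with
      | zero => norm_num
      | succ r ih => rw [Finset.sum_range_succ, ih]; ring
    rw [this]
    have : (0 : ℝ) < (1 / 2) ^ (r + 2) := by positivity
    linarith
  unfold av at hN2
  rw [← add_div, ← sub_div, div_lt_iff₀ hNR] at hN2
  have h8 : (∑ s ∈ Finset.range N, H N (sh s (row W)) + ∑ s ∈ Finset.range N, H N (sh s G) -
      ∑ s ∈ Finset.range N, H N (sh s (row W ∪ G))) / Real.log 2 < N / 4 := by
    rw [div_lt_iff₀ hl2]; linarith
  nlinarith

end
end AsymLY

namespace AsymLY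

section
variable {X : Type*} [TopologicalSpace X]

/-- The finite-valued variables: bits in row `0`, partition names in the other rows. -/
noncomputable def Zf (T : X ≃ₜ X) (Pt : ℕ → X → ℕ) (I : Finset ℤ) (x : ({t // t ∈ I} → Bool) → X)
    (a : ℕ × ℤ) (ω : {t // t ∈ I} → Bool) : ℕ :=
  match a with
  | (0, t) => if h : t ∈ I then (if ω ⟨t, h⟩ then 1 else 0) else 2
  | (j + 1, t) => Pt j ((T ^ t) (x ω))

/-- Alphabet sizes. -/
def alph (R : ℕ → ℕ) : ℕ → ℕ
  | 0 => 3
  | j + 1 => R j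

lemma Zf_lt (T : X ≃ₜ X) {Pt : ℕ → X → ℕ} {R : ℕ → ℕ} (hR : ∀ j x, Pt j x < R j) (I : Finset ℤ)
    (x : ({t // t ∈ I} → Bool) → X) (a : ℕ × ℤ) (ω : {t // t ∈ I} → Bool) :
    Zf T Pt I x a ω < alph R a.1 := by
  rcases a with ⟨_ | j, t⟩
  · simp only [Zf, alph]; split_ifs <;> omega
  · exact hR j _

lemma fent_Zf_row (T : X ≃ₜ X) (Pt : ℕ → X → ℕ) (I : Finset ℤ) (x : ({t // t ∈ I} → Bool) → X)
    (W : Finset ℤ) : fent (Zf T Pt I x) (row W) = ((W ∩ I).card : ℝ) * Real.log 2 := by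
  have hagr : ∀ ω, ((agr (Zf T Pt I x) (row W) ω).card : ℝ) =
      2 ^ ((Finset.univ.filter fun t : {t // t ∈ I} => (t : ℤ) ∉ W).card) := by
    intro ω
    have e : agr (Zf T Pt I x) (row W) ω =
        Fintype.piFinset (fun t : {t // t ∈ I} =>
          if (t : ℤ) ∈ W then {ω t} else (Finset.univ : Finset Bool)) := by
      ext ω'
      rw [mem_agr, Fintype.mem_piFinset]
      constructor
      · rintro h ⟨t, ht⟩
        simp only
        split_ifs with hW
        · have := h (0, t) (mem_row.2 ⟨rfl, hW⟩)
          simp only [Zf, ht, dif_pos] at this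
          rw [Finset.mem_singleton]
          cases h1 : ω' ⟨t, ht⟩ <;> cases h2 : ω ⟨t, ht⟩ <;> simp_all
        · simp
      · rintro h ⟨j, t⟩ ha
        obtain ⟨h1, h2⟩ := mem_row.1 ha
        simp only at h1 h2
        subst h1
        simp only [Zf]
        split_ifs with ht h3 h4 <;> try rfl
        all_goals
          have h5 := h ⟨t, ht⟩
          simp only [h2, if_true, Finset.mem_singleton] at h5
          simp_all
    rw [e, Fintype.card_piFinset]
    have : ∀ t : {t // t ∈ I}, (if (t : ℤ) ∈ W then {ω t} else (Finset.univ : Finset Bool)).card =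
        if (t : ℤ) ∉ W then 2 else 1 := by
      intro t; split_ifs <;> simp_all
    simp only [this]
    rw [Finset.prod_ite]
    simp
  have hcard : (Fintype.card ({t // t ∈ I} → Bool) : ℝ) = 2 ^ ((W ∩ I).card +
      (Finset.univ.filter fun t : {t // t ∈ I} => (t : ℤ) ∉ W).card) := by
    rw [Fintype.card_fun, Fintype.card_bool]
    push_cast
    congr 1
    have h1 := Finset.card_filter_add_card_filter_not (s := (Finset.univ : Finset {t // t ∈ I}))
      (fun t => (t : ℤ) ∈ W)
    rw [Finset.card_univ] at h1
    rw [← h1]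
    congr 1
    refine Finset.card_bij (fun t _ => (t : ℤ)) ?_ ?_ ?_
    · intro t ht; rw [Finset.mem_inter]; exact ⟨(Finset.mem_filter.1 ht).2, t.2⟩
    · intro a _ b _ h; exact Subtype.ext h
    · intro t ht
      rw [Finset.mem_inter] at ht
      exact ⟨⟨t, ht.2⟩, by simpa using ht.1, rfl⟩
  unfold fent
  have : ∀ ω : {t // t ∈ I} → Bool, Real.log ((Fintype.card ({t // t ∈ I} → Bool) : ℝ) /
      ((agr (Zf T Pt I x) (row W) ω).card : ℝ)) = ((W ∩ I).card : ℝ) * Real.log 2 := by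
    intro ω
    rw [hagr, hcard, pow_add, mul_div_assoc, div_self (by positivity), mul_one, Real.log_pow]
  rw [Finset.sum_congr rfl (fun ω _ => this ω), Finset.sum_const, nsmul_eq_mul, Finset.card_univ,
    mul_div_assoc, mul_comm, div_mul_cancel₀]
  exact (card_pos' (Ω := {t // t ∈ I} → Bool)).ne'

lemma fent_Zf_le (T : X ≃ₜ X) {Pt : ℕ → X → ℕ} {R : ℕ → ℕ} (hR : ∀ j x, Pt j x < R j)
    (I : Finset ℤ) (x : ({t // t ∈ I} → Bool) → X) (A : Finset (ℕ × ℤ)) :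
    fent (Zf T Pt I x) A ≤ ∑ a ∈ A, Real.log (alph R a.1) := by
  induction A using Finset.induction_on with
  | empty => rw [fent_empty]; simp
  | insert a A ha ih =>
    rw [Finset.sum_insert ha, Finset.insert_eq]
    have h1 := fent_submod (Zf T Pt I x) (A := {a}) (B := A) (C := ∅) (by simp) (by simp)
    have h2 := fent_cond_le (Zf T Pt I x) {a} ∅ (alph R a.1) (Zf T Pt I x a) (by simp) (by
      intro ω
      refine (Finset.card_le_card (t := Finset.range (alph R a.1)) ?_).trans (by simp)
      intro v hv
      obtain ⟨ω', _, rfl⟩ := Finset.mem_image.1 hv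
      exact Finset.mem_range.2 (Zf_lt T hR I x a ω'))
    rw [Finset.union_empty, fent_empty] at h2
    rw [fent_empty] at h1
    linarith

lemma HSys_of (T : X ≃ₜ X) {U V : Set X} {Pt : ℕ → X → ℕ} {R : ℕ → ℕ}
    (hR : ∀ j x, Pt j x < R j) {c : ℝ} (I : ℕ → Finset ℤ)
    (hI1 : ∀ N : ℕ, I N ⊆ Finset.Ico (0 : ℤ) N) (hI2 : ∀ N, Indp T U V (I N))
    (hI3 : ∀ N : ℕ, 1 ≤ N → c * N ≤ (I N).card) (x : ∀ N, ({t // t ∈ I N} → Bool) → X) :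
    HSys c (phi T U V) I (fun A => ∑ a ∈ A, Real.log (alph R a.1))
      (fun N A => fent (Zf T Pt (I N) (x N)) A) where
  empty N := fent_empty _
  mono N := fun h => fent_mono _ h
  submod N := fun h h' => fent_submod _ h h'
  bound N A := fent_Zf_le T hR _ _ _
  Cshift n A := by
    unfold sh
    rw [Finset.sum_image]
    intro a _ b _ h
    simp only [Prod.mk.injEq, add_left_inj] at h
    exact Prod.ext h.1 h.2
  hrow N W := fent_Zf_row T Pt _ _ W
  sub := hI1
  dens := hI3
  loc N a L := card_le_phi ((hI2 N).mono Finset.inter_subset_right) a L Finset.inter_subset_left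

/-- Finite models of the asymptotic configurations. -/
lemma finite_model [Nonempty X] (T : X ≃ₜ X) {U V : Set X} (hUV : Disjoint U V)
    (hent : 0 < coverEntropyOf T ![Uᶜ, Vᶜ]) {Pt : ℕ → X → ℕ} {R : ℕ → ℕ}
    (hR : ∀ j x, Pt j x < R j) :
    ∃ L k l m : ℕ → ℕ, (∀ i, i ≤ l i) ∧ (∀ i, L i + i + 1 ≤ m i) ∧
      (∀ i i', i' < i → m i' + L i ≤ m i) ∧
      ∀ r : ℕ, ∃ (d : ℕ → ℤ) (S : Finset (ℕ → Bool)) (z : (ℕ → Bool) → X),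
        (∀ i < r + 1, d i ∈ Finset.Ico (-(m i : ℤ)) (-(m i : ℤ) + L i)) ∧
        2 ^ r ≤ S.card ∧ (∀ σ ∈ S, ∀ i, r < i → σ i = false) ∧
        (∀ σ ∈ S, ∀ i < r + 1, (T ^ (d i)) (z σ) ∈ (if σ i then U else V)) ∧
        (∀ σ ∈ S, ∀ σ' ∈ S, ∀ j < r + 1,
          (∀ t : ℤ, k j ≤ t → t ≤ r → Pt j ((T ^ t) (z σ)) = Pt j ((T ^ t) (z σ'))) ∧
          Pt j ((T ^ (-(l j : ℤ))) (z σ)) = Pt j ((T ^ (-(l j : ℤ))) (z σ'))) := by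
  obtain ⟨c, hc, hc1, hc2⟩ := phi_opt T hUV hent
  have hl2 : 0 < Real.log 2 := Real.log_pos (by norm_num)
  choose I hI1 hI2 hI3 using exists_phi T U V
  have hx : ∀ N, ∀ ω : {t // t ∈ I N} → Bool, ∃ x : X, ∀ t : {t // t ∈ I N},
      (T ^ (t : ℤ)) x ∈ (if ω t then U else V) := by
    intro N ω
    obtain ⟨x, hx⟩ := hI2 N (fun t => if h : t ∈ I N then ω ⟨t, h⟩ else false)
    refine ⟨x, fun t => ?_⟩
    have := hx t t.2
    simpa using this
  choose x hx using hx
  have S := HSys_of T (c := c) hR I hI1 hI2 (fun N hN => by rw [hI3]; exact hc1 N hN) x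
  obtain ⟨f, h0, P, hh, hf⟩ := S.lim
  have hLex : ∀ i : ℕ, ∃ L : ℕ, 1 ≤ L ∧ phi T U V L * (1 - (1 / 2 : ℝ) ^ (i + 3)) ≤ c * L :=
    fun i => hc2 _ (by positivity) (pow_lt_one₀ (by norm_num) (by norm_num) (by omega))
  choose L hL hLδ using hLex
  obtain ⟨k, l, m, hl, hm1, hm2, hmain⟩ := abstract_times P L
    (show 0 < Real.log 2 / 8 by positivity)
  refine ⟨L, k, l, m, hl, hm1, hm2, fun r => ?_⟩
  set W := (Finset.range (r + 1)).biUnion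
    fun i => Finset.Ico (-(m i : ℤ)) (-(m i : ℤ) + L i) with hW
  set F' : Finset (ℕ × ℤ) := (Finset.range (r + 1)).biUnion
    (fun j => (Finset.Icc (k j : ℤ) r).image (fun t => (j + 1, t))) with hF'
  have hF'sub : (F' : Set (ℕ × ℤ)) ⊆ Fi k := by
    intro a ha
    rw [hF', Finset.mem_coe, Finset.mem_biUnion] at ha
    obtain ⟨j, _, ha⟩ := ha
    obtain ⟨t, ht, rfl⟩ := Finset.mem_image.1 ha
    exact Or.inr ⟨j, rfl, (Finset.mem_Icc.1 ht).1⟩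
  have hI := hmain (r + 1) F' hF'sub
  rw [← hW] at hI
  set G : Finset (ℕ × ℤ) := F' ∪ (Finset.range (r + 1)).image (fun j => (j + 1, -(l j : ℤ))) with hG
  obtain ⟨N, s, hg, hd⟩ := S.good_shift P hc hh hf L m hL hLδ hc1 (r + 1) W G hI
  choose! d hd1 hd2 using hd
  set Z := Zf T Pt (I N) (x N) with hZ
  set D : Finset ℤ := (Finset.range (r + 1)).image d with hD
  have hDW : D ⊆ W := by
    intro t ht
    obtain ⟨i, hi, rfl⟩ := Finset.mem_image.1 ht
    exact Finset.mem_biUnion.2 ⟨i, hi, hd1 i (Finset.mem_range.1 hi)⟩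
  have hdinj : ∀ i < r + 1, ∀ i' < i, d i < d i' := by
    intro i hi i' hi'
    have h1 := Finset.mem_Ico.1 (hd1 i hi)
    have h2 := Finset.mem_Ico.1 (hd1 i' (by omega))
    have := hm2 i i' hi'
    omega
  have hDcard : D.card = r + 1 := by
    rw [hD, Finset.card_image_of_injOn, Finset.card_range]
    intro a ha b hb hab
    have ha := Finset.mem_range.1 (Finset.mem_coe.1 ha)
    have hb := Finset.mem_range.1 (Finset.mem_coe.1 hb)
    rcases lt_trichotomy a b with h | h | h
    · have := hdinj b hb a h; omega
    · exact h
    · have := hdinj a ha b h; omega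
  have hHD : fent Z (sh s (row D)) = ((r + 1 : ℕ) : ℝ) * Real.log 2 := by
    rw [sh_row, hZ, fent_Zf_row, Finset.inter_eq_left.2,
      Finset.card_image_of_injective _ (add_left_injective _), hDcard]
    intro t ht
    obtain ⟨u, hu, rfl⟩ := Finset.mem_image.1 ht
    obtain ⟨i, hi, rfl⟩ := Finset.mem_image.1 hu
    exact hd2 i (Finset.mem_range.1 hi)
  have hrowDW : row D ⊆ row W := fun a ha => by
    rw [mem_row] at *; exact ⟨ha.1, hDW ha.2⟩
  have hsub := fent_submod Z (A := sh s (row W)) (B := sh s (row D) ∪ sh s G) (C := sh s (row D))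
    (fun a ha => by rw [mem_sh] at *; exact hrowDW ha) Finset.subset_union_left
  have eU : sh s (row W) ∪ (sh s (row D) ∪ sh s G) = sh s (row W ∪ G) := by
    rw [← Finset.union_assoc, ← sh_union, ← sh_union, Finset.union_eq_left.2 hrowDW]
  rw [eU, hHD] at hsub
  let pat : ({t // t ∈ I N} → Bool) → (ℕ → Bool) := fun ω i =>
    if h : i < r + 1 then ω ⟨d i + s, hd2 i h⟩ else false
  have hpat : ∀ ω ω', pat ω = pat ω' ↔ ∀ a ∈ sh s (row D), Z a ω = Z a ω' := by
    intro ω ω'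
    constructor
    · rintro h ⟨j, t⟩ ha
      rw [sh_row, mem_row] at ha
      obtain ⟨h1, h2⟩ := ha
      simp only at h1 h2
      subst h1
      obtain ⟨u, hu, rfl⟩ := Finset.mem_image.1 h2
      obtain ⟨i, hi, rfl⟩ := Finset.mem_image.1 hu
      have hi := Finset.mem_range.1 hi
      have h3 := congrFun h i
      simp only [pat, hi, dif_pos] at h3
      simp only [hZ, Zf, hd2 i hi, dif_pos, h3]
    · intro h
      funext i
      by_cases hi : i < r + 1
      · have := h (0, d i + s) (by
          rw [sh_row, mem_row]
          exact ⟨rfl, Finset.mem_image_of_mem _ (Finset.mem_image_of_mem _ (Finset.mem_range.2 hi))⟩)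
        simp only [hZ, Zf, hd2 i hi, dif_pos] at this
        simp only [pat, hi, dif_pos]
        cases h1 : ω ⟨d i + s, hd2 i hi⟩ <;> cases h2 : ω' ⟨d i + s, hd2 i hi⟩ <;> simp_all
      · simp only [pat, hi, dif_neg, not_false_eq_true]
  have hbig : ∃ ω, 2 ^ r < ((agr Z (sh s G) ω).image pat).card := by
    by_contra! hcon
    have h1 := fent_cond_le Z (sh s (row D)) (sh s G) (2 ^ r) pat hpat hcon
    push_cast at h1 hsub
    rw [Real.log_pow] at h1
    linarith
  obtain ⟨ω₀, hω₀⟩ := hbig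
  have hz : ∀ σ ∈ (agr Z (sh s G) ω₀).image pat, ∃ ω ∈ agr Z (sh s G) ω₀, pat ω = σ := fun σ hσ =>
    Finset.mem_image.1 hσ
  choose! w hw1 hw2 using hz
  refine ⟨d, (agr Z (sh s G) ω₀).image pat, fun σ => (T ^ (s : ℤ)) (x N (w σ)),
    hd1, hω₀.le, ?_, ?_, ?_⟩
  · intro σ hσ i hi
    rw [← hw2 σ hσ]
    simp only [pat]
    rw [dif_neg (by omega)]
  · intro σ hσ i hi
    rw [← hpow_add]
    have h1 := hx N (w σ) ⟨d i + s, hd2 i hi⟩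
    have h2 : w σ ⟨d i + s, hd2 i hi⟩ = σ i := by
      conv_rhs => rw [← hw2 σ hσ]
      simp only [pat, hi, dif_pos]
    rw [h2] at h1
    exact h1
  · intro σ hσ σ' hσ' j hj
    have key : ∀ t : ℤ, (j + 1, t) ∈ G →
        Pt j ((T ^ t) ((T ^ (s : ℤ)) (x N (w σ)))) = Pt j ((T ^ t) ((T ^ (s : ℤ)) (x N (w σ')))) := by
      intro t ht
      have hmem : (j + 1, t + (s : ℤ)) ∈ sh s G := by
        rw [mem_sh]; simpa using ht
      have h1 := mem_agr.1 (hw1 σ hσ) _ hmem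
      have h2 := mem_agr.1 (hw1 σ' hσ') _ hmem
      simp only [hZ, Zf] at h1 h2
      rw [← hpow_add, ← hpow_add, h1, h2]
    refine ⟨fun t h1 h2 => key t ?_, key _ ?_⟩
    · refine Finset.mem_union_left _ (Finset.mem_biUnion.2 ⟨j, Finset.mem_range.2 hj, ?_⟩)
      exact Finset.mem_image_of_mem _ (Finset.mem_Icc.2 ⟨h1, h2⟩)
    · exact Finset.mem_union_right _ (Finset.mem_image_of_mem (fun j => (j + 1, -(l j : ℤ)))
        (Finset.mem_range.2 hj))

end
end AsymLY

namespace AsymLY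

lemma exists_parts (X : Type*) [MetricSpace X] [CompactSpace X] :
    ∃ (Pt : ℕ → X → ℕ) (R : ℕ → ℕ), (∀ j x, Pt j x < R j) ∧
      ∀ j x y, Pt j x = Pt j y → dist x y ≤ 1 / ((j : ℝ) + 1) := by
  have h : ∀ j : ℕ, ∃ (P : X → ℕ) (R : ℕ), (∀ x, P x < R) ∧
      ∀ x y, P x = P y → dist x y ≤ 1 / ((j : ℝ) + 1) := by
    intro j
    have hε : (0 : ℝ) < 1 / ((j : ℝ) + 1) / 2 := by positivity
    obtain ⟨t, -, ht, hcov⟩ := finite_cover_balls_of_compact (isCompact_univ (X := X)) hε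
    have hc : ∀ x : X, ∃ c ∈ ht.toFinset, dist x c < 1 / ((j : ℝ) + 1) / 2 := by
      intro x
      have := hcov (mem_univ x)
      simp only [mem_iUnion, exists_prop] at this
      obtain ⟨c, hc, hx⟩ := this
      exact ⟨c, ht.mem_toFinset.2 hc, hx⟩
    choose c hc1 hc2 using hc
    refine ⟨fun x => (ht.toFinset.equivFin ⟨c x, hc1 x⟩ : ℕ), ht.toFinset.card,
      fun x => Fin.is_lt _, fun x y hxy => ?_⟩
    have h1 := ht.toFinset.equivFin.injective (Fin.ext hxy)
    have h2 : c x = c y := congrArg Subtype.val h1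
    have h3 := hc2 x
    have h4 := hc2 y
    rw [← h2] at h4
    have := dist_triangle_right x y (c x)
    linarith
  choose P R h1 h2 using h
  exact ⟨P, R, h1, h2⟩

lemma geom_two_lt (n : ℕ) : ∑ i ∈ Finset.range n, 2 ^ (n - 1 - i) < 2 ^ n := by
  rw [Finset.sum_range_reflect (fun i => 2 ^ i) n]
  induction n with
  | zero => simp
  | succ n ih => rw [Finset.sum_range_succ, pow_succ]; omega

lemma card_cyl_le {r : ℕ} (S : Finset (ℕ → Bool)) (h2 : ∀ σ ∈ S, ∀ i, r < i → σ i = false)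
    (a : ℕ → Bool) (q : ℕ) :
    (S.filter fun τ => ∀ p < q, τ p = a p).card ≤ 2 ^ (r + 1 - q) := by
  have : 2 ^ (r + 1 - q) = ((Finset.Ico q (r + 1)).powerset).card := by
    rw [Finset.card_powerset, Nat.card_Ico]
  rw [this]
  refine Finset.card_le_card_of_injOn
    (fun τ => (Finset.Ico q (r + 1)).filter fun p => τ p = true) ?_ ?_
  · intro τ _
    exact Finset.mem_coe.2 (Finset.mem_powerset.2 (Finset.filter_subset _ _))
  · intro τ hτ τ' hτ' h
    obtain ⟨hS, hq⟩ := Finset.mem_filter.1 (Finset.mem_coe.1 hτ)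
    obtain ⟨hS', hq'⟩ := Finset.mem_filter.1 (Finset.mem_coe.1 hτ')
    funext p
    by_cases hp : p < q
    · rw [hq p hp, hq' p hp]
    · by_cases hr : r < p
      · rw [h2 τ hS p hr, h2 τ' hS' p hr]
      · have h3 : p ∈ (Finset.Ico q (r + 1)).filter (fun p => τ p = true) ↔
            p ∈ (Finset.Ico q (r + 1)).filter (fun p => τ' p = true) := by
          simp only at h
          rw [h]
        have hI : p ∈ Finset.Ico q (r + 1) := Finset.mem_Ico.2 ⟨by omega, by omega⟩
        simp only [Finset.mem_filter, hI, true_and] at h3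
        exact Bool.eq_iff_iff.2 h3

lemma limset_uncountable (S : ℕ → Finset (ℕ → Bool)) (h1 : ∀ r, 2 ^ r ≤ (S r).card)
    (h2 : ∀ r, ∀ σ ∈ S r, ∀ i, r < i → σ i = false) (u : Ultrafilter ℕ)
    (hu : (u : Filter ℕ) ≤ atTop) :
    ¬ {σ : ℕ → Bool | ∀ q, ∀ᶠ r in (u : Filter ℕ), ∃ τ ∈ S r, ∀ i < q, τ i = σ i}.Countable := by
  intro hc
  obtain ⟨a, ha⟩ := Set.countable_iff_exists_subset_range.1 hc
  have hτ : ∀ r, ∃ τ ∈ S r, ∀ i, i < r - 1 → ¬ ∀ p < i + 3, τ p = a i p := by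
    intro r
    by_contra! hcon
    have hsub : S r ⊆ (Finset.range (r - 1)).biUnion
        fun i => (S r).filter fun τ => ∀ p < i + 3, τ p = a i p := by
      intro τ hτ
      obtain ⟨i, hi, h⟩ := hcon τ hτ
      exact Finset.mem_biUnion.2 ⟨i, Finset.mem_range.2 hi, Finset.mem_filter.2 ⟨hτ, h⟩⟩
    have h3 := (h1 r).trans ((Finset.card_le_card hsub).trans (Finset.card_biUnion_le))
    have h4 := Finset.sum_le_sum (s := Finset.range (r - 1))
      fun i _ => card_cyl_le (S r) (h2 r) (a i) (i + 3)
    have h5 : ∑ i ∈ Finset.range (r - 1), 2 ^ (r + 1 - (i + 3)) =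
        ∑ i ∈ Finset.range (r - 1), 2 ^ (r - 1 - 1 - i) := by
      refine Finset.sum_congr rfl fun i _ => ?_
      congr 1; omega
    have h6 := geom_two_lt (r - 1)
    have h7 : 2 ^ (r - 1) ≤ 2 ^ r := Nat.pow_le_pow_right (by norm_num) (by omega)
    omega
  choose τ hτS hτa using hτ
  let σ : ℕ → Bool := fun i => decide (∀ᶠ r in (u : Filter ℕ), τ r i = true)
  have hσ : ∀ i, ∀ᶠ r in (u : Filter ℕ), τ r i = σ i := by
    intro i
    by_cases h : ∀ᶠ r in (u : Filter ℕ), τ r i = true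
    · have : σ i = true := by simp only [σ, h, decide_true]
      rw [this]; exact h
    · have : σ i = false := by simp only [σ, h, decide_false]
      rw [this]
      have := Ultrafilter.eventually_not.2 h
      filter_upwards [this] with r hr
      simpa using hr
  have hσq : ∀ q, ∀ᶠ r in (u : Filter ℕ), ∀ i < q, τ r i = σ i := by
    intro q
    have := (Filter.eventually_all_finset (Finset.range q)).2 (fun i _ => hσ i)
    filter_upwards [this] with r hr i hi using hr i (Finset.mem_range.2 hi)
  have hmem := ha (show σ ∈ {σ : ℕ → Bool | ∀ q, ∀ᶠ r in (u : Filter ℕ),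
    ∃ τ ∈ S r, ∀ i < q, τ i = σ i} from fun q => by
      filter_upwards [hσq q] with r hr using ⟨τ r, hτS r, hr⟩)
  obtain ⟨i, hi⟩ := hmem
  obtain ⟨r, hr1, hr2⟩ := ((hσq (i + 3)).and (hu (eventually_ge_atTop (i + 2)))).exists
  have hr2' : i + 2 ≤ r := hr2
  exact hτa r i (by omega) (by rw [hi]; exact hr1)

lemma limit_model {X : Type*} [MetricSpace X] [CompactSpace X] [Nonempty X] (T : X ≃ₜ X)
    {U V : Set X} (hU : IsClosed U) (hV : IsClosed V) (hUV : Disjoint U V)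
    (hent : 0 < coverEntropyOf T ![Uᶜ, Vᶜ]) :
    ∃ (A : Set (ℕ → Bool)) (x : (ℕ → Bool) → X) (D : ℕ → ℤ) (k l : ℕ → ℕ),
      ¬ A.Countable ∧ (∀ i, D i ≤ -(i : ℤ)) ∧ (∀ i, i ≤ l i) ∧
      (∀ σ ∈ A, ∀ i, (T ^ (D i)) (x σ) ∈ (if σ i then U else V)) ∧
      ∀ σ ∈ A, ∀ σ' ∈ A, ∀ j : ℕ,
        (∀ t : ℤ, k j ≤ t → dist ((T ^ t) (x σ)) ((T ^ t) (x σ')) ≤ 1 / ((j : ℝ) + 1)) ∧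
        dist ((T ^ (-(l j : ℤ))) (x σ)) ((T ^ (-(l j : ℤ))) (x σ')) ≤ 1 / ((j : ℝ) + 1) := by
  obtain ⟨Pt, R, hR, hPt⟩ := exists_parts X
  obtain ⟨L, k, l, m, hl, hm1, -, h⟩ := finite_model T hUV hent hR
  choose d S z hd hS1 hS2 hz1 hz2 using h
  let u : Ultrafilter ℕ := Filter.hyperfilter ℕ
  have hu : (u : Filter ℕ) ≤ atTop := hyper_atTop
  have hge : ∀ n : ℕ, ∀ᶠ r in (u : Filter ℕ), n ≤ r := fun n => hu (eventually_ge_atTop n)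
  have hD : ∀ i : ℕ, ∃ v : ℤ, v ≤ -(i : ℤ) ∧ ∀ᶠ r in (u : Filter ℕ), d r i = v := by
    intro i
    have h1 : ∀ᶠ r in (u : Filter ℕ), ∃ v ∈ (Finset.Ico (-(m i : ℤ)) (-(m i : ℤ) + L i) : Set ℤ),
        d r i = v := by
      filter_upwards [hge i] with r hr
      exact ⟨d r i, hd r i (by omega), rfl⟩
    rw [Ultrafilter.eventually_exists_mem_iff (Finset.finite_toSet _)] at h1
    obtain ⟨v, hv, h1⟩ := h1
    refine ⟨v, ?_, h1⟩
    have := Finset.mem_Ico.1 (Finset.mem_coe.1 hv)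
    have := hm1 i
    omega
  choose D hD1 hD2 using hD
  let A := {σ : ℕ → Bool | ∀ q, ∀ᶠ r in (u : Filter ℕ), ∃ τ ∈ S r, ∀ i < q, τ i = σ i}
  have hτ : ∀ σ ∈ A, ∃ τ : ℕ → ℕ → Bool, (∀ r, τ r ∈ S r) ∧
      ∀ q, ∀ᶠ r in (u : Filter ℕ), ∀ i < q, τ r i = σ i := by
    intro σ hσ
    have h0 : ∀ r, ∃ τ ∈ S r, ∀ i < Nat.findGreatest
        (fun q => ∃ τ ∈ S r, ∀ i < q, τ i = σ i) r, τ i = σ i := by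
      intro r
      refine Nat.findGreatest_spec (P := fun q => ∃ τ ∈ S r, ∀ i < q, τ i = σ i)
        (Nat.zero_le r) ?_
      have : 0 < (S r).card := lt_of_lt_of_le (by positivity) (hS1 r)
      obtain ⟨τ, hτ⟩ := Finset.card_pos.1 this
      exact ⟨τ, hτ, fun i hi => absurd hi (Nat.not_lt_zero i)⟩
    choose τ hτ1 hτ2 using h0
    refine ⟨τ, hτ1, fun q => ?_⟩
    filter_upwards [hσ q, hge q] with r hr hqr i hi
    exact hτ2 r i (lt_of_lt_of_le hi (Nat.le_findGreatest hqr hr))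
  choose! τ hτ1 hτ2 using hτ
  have hx : ∀ σ : ℕ → Bool, ∃ x : X, Tendsto (fun r => z r (τ σ r)) u (𝓝 x) := by
    intro σ
    obtain ⟨x, -, hx⟩ := isCompact_univ.ultrafilter_le_nhds
      (u.map fun r => z r (τ σ r)) (by simp)
    exact ⟨x, hx⟩
  choose x hx using hx
  refine ⟨A, x, D, k, l, limset_uncountable S hS1 hS2 u hu, hD1, hl, ?_, ?_⟩
  · intro σ hσ i
    have hcl : IsClosed (if σ i then U else V) := by split_ifs <;> assumption
    refine hcl.mem_of_tendsto (((T ^ (D i)).continuous.tendsto _).comp (hx σ)) ?_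
    filter_upwards [hτ2 σ hσ (i + 1), hge i, hD2 i] with r h1 h2 h3
    have h4 := hz1 r (τ σ r) (hτ1 σ hσ r) i (by omega)
    rw [h3, h1 i (by omega)] at h4
    exact h4
  · intro σ hσ σ' hσ' j
    refine ⟨fun t ht => ?_, ?_⟩
    · refine le_of_tendsto ((((T ^ t).continuous.tendsto _).comp (hx σ)).dist
        (((T ^ t).continuous.tendsto _).comp (hx σ'))) ?_
      filter_upwards [hge j, hge t.toNat] with r h1 h2
      exact hPt j _ _ ((hz2 r _ (hτ1 σ hσ r) _ (hτ1 σ' hσ' r) j (by omega)).1 t ht (by omega))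
    · refine le_of_tendsto ((((T ^ (-(l j : ℤ))).continuous.tendsto _).comp (hx σ)).dist
        (((T ^ (-(l j : ℤ))).continuous.tendsto _).comp (hx σ'))) ?_
      filter_upwards [hge j] with r h1
      exact hPt j _ _ (hz2 r _ (hτ1 σ hσ r) _ (hτ1 σ' hσ' r) j (by omega)).2

lemma tail_countable (σ : ℕ → Bool) :
    {σ' : ℕ → Bool | ¬ ∀ N, ∃ i, N ≤ i ∧ σ i ≠ σ' i}.Countable := by
  have : {σ' : ℕ → Bool | ¬ ∀ N, ∃ i, N ≤ i ∧ σ i ≠ σ' i} ⊆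
      range (fun s : Finset ℕ => fun i => if i ∈ s then !(σ i) else σ i) := by
    intro σ' h
    simp only [mem_ofPred_eq, not_forall, not_exists, not_and, not_not] at h
    obtain ⟨N, hN⟩ := h
    refine ⟨(Finset.range N).filter fun i => σ i ≠ σ' i, ?_⟩
    funext i
    simp only [Finset.mem_filter, Finset.mem_range]
    by_cases hi : i < N
    · cases h1 : σ i <;> cases h2 : σ' i <;> simp_all
    · simp [hi, hN i (by omega)]
  exact (Set.countable_range _).mono this

lemma main_aux {X : Type*} [MetricSpace X] [CompactSpace X] [Nonempty X] (T : X ≃ₜ X)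
    {U V : Set X} (hU : IsClosed U) (hV : IsClosed V) (hUV : Disjoint U V) {δ : ℝ}
    (hdist : ∀ a ∈ U, ∀ b ∈ V, δ ≤ dist a b)
    (hent : 0 < coverEntropyOf T ![Uᶜ, Vᶜ]) :
    ∃ F : Set X, ¬ F.Countable ∧
      ∀ x ∈ F, ∃ Fx : Set X, ¬ Fx.Countable ∧
        ∀ y ∈ Fx,
          IsAsymptoticPair (⇑T) x y ∧
          Filter.liminf (fun n : ℕ => dist ((⇑T.symm)^[n] x) ((⇑T.symm)^[n] y)) atTop = 0 ∧
          δ ≤ Filter.limsup (fun n : ℕ => dist ((⇑T.symm)^[n] x) ((⇑T.symm)^[n] y)) atTop := by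
  obtain ⟨A, x, D, k, l, hA, hD, hl, hUV', hclose⟩ := limit_model T hU hV hUV hent
  have hinj : InjOn x A := by
    intro σ hσ σ' hσ' h
    funext i
    have h1 := hUV' σ hσ i
    have h2 := hUV' σ' hσ' i
    rw [← h] at h2
    cases e1 : σ i <;> cases e2 : σ' i <;> simp only [e1, e2, if_true] at h1 h2 ⊢
    · exact absurd h1 (Set.disjoint_left.1 hUV (by simpa using h2))
    · exact absurd h2 (Set.disjoint_left.1 hUV (by simpa using h1))
  refine ⟨x '' A, fun h => hA (Set.countable_of_injective_of_countable_image hinj h), ?_⟩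
  rintro _ ⟨σ, hσ, rfl⟩
  refine ⟨x '' (A ∩ {σ' | ∀ N, ∃ i, N ≤ i ∧ σ i ≠ σ' i}), ?_, ?_⟩
  · intro h
    have h1 := Set.countable_of_injective_of_countable_image (hinj.mono inter_subset_left) h
    refine hA ((h1.union (tail_countable σ)).mono ?_)
    intro τ hτ
    by_cases h2 : ∀ N, ∃ i, N ≤ i ∧ σ i ≠ τ i
    · exact Or.inl ⟨hτ, h2⟩
    · exact Or.inr h2
  rintro _ ⟨σ', ⟨hσ', hdiff⟩, rfl⟩
  have hbd : ∃ C, ∀ a b : X, dist a b ≤ C := by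
    obtain ⟨C, hC⟩ := Metric.isBounded_iff.1 (isCompact_univ (X := X)).isBounded
    exact ⟨C, fun a b => hC (mem_univ a) (mem_univ b)⟩
  obtain ⟨C, hC⟩ := hbd
  have hb1 : IsBoundedUnder (· ≤ ·) atTop
      (fun n : ℕ => dist ((⇑T.symm)^[n] (x σ)) ((⇑T.symm)^[n] (x σ'))) :=
    isBoundedUnder_of ⟨C, fun n => hC _ _⟩
  have hb2 : IsBoundedUnder (· ≥ ·) atTop
      (fun n : ℕ => dist ((⇑T.symm)^[n] (x σ)) ((⇑T.symm)^[n] (x σ'))) :=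
    isBoundedUnder_of ⟨0, fun n => dist_nonneg⟩
  have hsmall : ∀ ε : ℝ, 0 < ε → ∃ j0 : ℕ, ∀ j ≥ j0, 1 / ((j : ℝ) + 1) < ε := by
    intro ε hε
    obtain ⟨j0, hj0⟩ := exists_nat_one_div_lt hε
    exact ⟨j0, fun j hj => lt_of_le_of_lt (Nat.one_div_le_one_div hj) hj0⟩
  refine ⟨?_, ?_, ?_⟩
  · unfold IsAsymptoticPair
    rw [Metric.tendsto_atTop]
    intro ε hε
    obtain ⟨j, hj⟩ := hsmall ε hε
    refine ⟨k j, fun n hn => ?_⟩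
    have h1 := (hclose σ hσ σ' hσ' j).1 n (by exact_mod_cast hn)
    rw [hpow_nat, hpow_nat] at h1
    rw [Real.dist_0_eq_abs, abs_of_nonneg dist_nonneg]
    exact lt_of_le_of_lt h1 (hj j le_rfl)
  · refine le_antisymm ?_ (le_liminf_of_le hb1.isCoboundedUnder_ge
      (Eventually.of_forall fun n => dist_nonneg))
    refine le_of_forall_pos_le_add fun ε hε => ?_
    rw [zero_add]
    obtain ⟨j0, hj0⟩ := hsmall ε hε
    refine liminf_le_of_frequently_le (frequently_atTop.2 fun N => ?_) hb2
    refine ⟨l (max N j0), (le_max_left _ _).trans (hl _), ?_⟩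
    have h1 := (hclose σ hσ σ' hσ' (max N j0)).2
    rw [hpow_neg, hpow_neg] at h1
    exact h1.trans (hj0 _ (le_max_right _ _)).le
  · refine le_limsup_of_frequently_le (frequently_atTop.2 fun N => ?_) hb1
    obtain ⟨i, hi, hne⟩ := hdiff N
    have hDi := hD i
    have e : D i = -(((-(D i)).toNat : ℕ) : ℤ) := by omega
    refine ⟨(-(D i)).toNat, by omega, ?_⟩
    have h1 := hUV' σ hσ i
    have h2 := hUV' σ' hσ' i
    rw [e, hpow_neg] at h1 h2
    cases e1 : σ i <;> cases e2 : σ' i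
    · exact absurd (e1.trans e2.symm) hne
    · rw [e1] at h1; rw [e2] at h2
      rw [dist_comm]
      exact hdist _ (by simpa using h2) _ (by simpa using h1)
    · rw [e1] at h1; rw [e2] at h2
      exact hdist _ (by simpa using h1) _ (by simpa using h2)
    · exact absurd (e1.trans e2.symm) hne

lemma main_thm {X : Type*} [MetricSpace X] [CompactSpace X] (T : X ≃ₜ X)
    (δ : ℝ) (hδpos : 0 < δ)
    (hδlt : δ < sSup ((fun p : X × X => dist p.1 p.2) ''
      {p : X × X | IsEntropyPair (⇑T) p.1 p.2})) :
    ∃ F : Set X, ¬ F.Countable ∧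
      ∀ x ∈ F, ∃ Fx : Set X, ¬ Fx.Countable ∧
        ∀ y ∈ Fx,
          IsAsymptoticPair (⇑T) x y ∧
          Filter.liminf (fun n : ℕ => dist ((⇑T.symm)^[n] x) ((⇑T.symm)^[n] y)) atTop = 0 ∧
          δ ≤ Filter.limsup (fun n : ℕ => dist ((⇑T.symm)^[n] x) ((⇑T.symm)^[n] y)) atTop := by
  have hne : ((fun p : X × X => dist p.1 p.2) ''
      {p : X × X | IsEntropyPair (⇑T) p.1 p.2}).Nonempty := by
    by_contra h
    rw [Set.not_nonempty_iff_eq_empty] at h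
    rw [h, Real.sSup_empty] at hδlt
    linarith
  obtain ⟨_, ⟨⟨a, b⟩, hab, rfl⟩, hlt⟩ := exists_lt_of_lt_csSup hne hδlt
  simp only [mem_ofPred_eq] at hab hlt
  have : Nonempty X := ⟨a⟩
  have hρ : 0 < (dist a b - δ) / 2 := by linarith
  have hdist : ∀ u ∈ Metric.closedBall a ((dist a b - δ) / 2),
      ∀ v ∈ Metric.closedBall b ((dist a b - δ) / 2), δ ≤ dist u v := by
    intro u hu v hv
    rw [Metric.mem_closedBall] at hu hv
    have h1 := dist_triangle4 a u v b
    rw [dist_comm a u] at h1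
    linarith
  have hdisj : Disjoint (Metric.closedBall a ((dist a b - δ) / 2))
      (Metric.closedBall b ((dist a b - δ) / 2)) := by
    rw [Set.disjoint_left]
    intro u hu hv
    have := hdist u hu u hv
    rw [dist_self] at this
    linarith
  exact main_aux T Metric.isClosed_closedBall Metric.isClosed_closedBall hdisj hdist
    (hab.2 _ _ Metric.isClosed_closedBall Metric.isClosed_closedBall
      (Metric.closedBall_mem_nhds a hρ) (Metric.closedBall_mem_nhds b hρ) hdisj)

end AsymLY

/-- If `h(X,T) > 0` and `0 < δ < sup { d(x,y) : (x,y) ∈ E(X,T) }`, then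
there is an uncountable set `F ⊆ X` and, for every `x ∈ F`, an uncountable set `F_x ⊆ X`
such that every `y ∈ F_x` is asymptotic to `x` for `T` and satisfies
`liminf d(T⁻ⁿx, T⁻ⁿy) = 0` and `limsup d(T⁻ⁿx, T⁻ⁿy) ≥ δ`. -/
theorem uncountably_many_asymptotic_LiYorke_pairs
    {X : Type*} [MetricSpace X] [CompactSpace X] (T : X ≃ₜ X)
    (hent : 0 < Dynamics.coverEntropy (⇑T) Set.univ)
    (δ : ℝ) (hδpos : 0 < δ)
    (hδlt : δ < sSup ((fun p : X × X => dist p.1 p.2) ''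
      {p : X × X | IsEntropyPair (⇑T) p.1 p.2})) :
    ∃ F : Set X, ¬ F.Countable ∧
      ∀ x ∈ F, ∃ Fx : Set X, ¬ Fx.Countable ∧
        ∀ y ∈ Fx,
          IsAsymptoticPair (⇑T) x y ∧
          Filter.liminf (fun n : ℕ => dist ((⇑T.symm)^[n] x) ((⇑T.symm)^[n] y)) atTop = 0 ∧
          δ ≤ Filter.limsup (fun n : ℕ => dist ((⇑T.symm)^[n] x) ((⇑T.symm)^[n] y)) atTop := by
  exact AsymLY.main_thm T δ hδpos hδlt
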